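/- arXiv:2605.18335 — 3 statements merged into one kernel-verified Lean document; each statement's English description precedes it below -/
import Mathlib

section
/- Let X_0 > 1 be a real constant and let X_1, ..., X_k be nonnegative real random variables on a probability space such that, almost surely, X_{i+1} − 1 ≥ 2(X_i − 1) for every 0 ≤ i < k, and such that the conditional expectation of X_{i+1} given X_0, ..., X_i is at most X_i^2 almost surely, for every 0 ≤ i < k. If τ is a real number with τ ≥ 1 + 4(X_0 − 1), then Pr[X_k ≥ τ^{2^k}] ≤ 48 ((X_0 − 1)/(τ − 1))^2. -/
open MeasureTheory

/-- Testing a conditional-expectation bound against a bounded nonnegative weight. -/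
lemma weighted_condExp_le {Ω : Type*} {m m0 : MeasurableSpace Ω} (μ : Measure Ω)
    [IsProbabilityMeasure μ] (hm : m ≤ m0) (g Y Z : Ω → ℝ) (C : ℝ)
    (hg : Measurable[m] g) (hg0 : ∀ ω, 0 ≤ g ω) (hgC : ∀ ω, g ω ≤ C)
    (hY : Integrable Y μ) (hZ : Integrable (fun ω => g ω * Z ω) μ)
    (h : μ[Y | m] ≤ᵐ[μ] Z) :
    ∫ ω, g ω * Y ω ∂μ ≤ ∫ ω, g ω * Z ω ∂μ := by
  have hgs : StronglyMeasurable[m] g := hg.stronglyMeasurable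
  have hb : ∀ ω, ‖g ω‖ ≤ C := fun ω => by
    rw [Real.norm_eq_abs, abs_of_nonneg (hg0 ω)]; exact hgC ω
  have h1 : μ[g * Y | m] =ᵐ[μ] g * μ[Y | m] :=
    condExp_stronglyMeasurable_mul_of_bound hm hgs hY C (Filter.Eventually.of_forall hb)
  have h2 : ∫ ω, (μ[g * Y | m]) ω ∂μ = ∫ ω, (g * Y) ω ∂μ := integral_condExp hm
  have h3 : ∫ ω, g ω * Y ω ∂μ = ∫ ω, (μ[g * Y | m]) ω ∂μ := h2.symm
  rw [h3]
  refine integral_mono_ae integrable_condExp hZ ?_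
  filter_upwards [h1, h] with ω e1 e2
  rw [e1]
  exact mul_le_mul_of_nonneg_left e2 (hg0 ω)

/-- The pointwise inequality: `a = X_i`, `b = X_{i+1}`, `s` the threshold at level `i`. -/
lemma pointwise_step (a b s : ℝ) (hs : 1 < s) (ha : 1 ≤ a) (hab : 2 * (a - 1) ≤ b - 1)
    (has : a ≤ s) :
    min 1 (((b - 1) / (s ^ 2 - 1)) ^ 2) ≤ min 1 (((a - 1) / (s - 1)) ^ 2)
      + (s ^ 2 - 1 + 2 * (a - 1)) / (s ^ 2 - 1) ^ 2 * (b - a ^ 2) := by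
  obtain ⟨t, rfl⟩ : ∃ t, s = t + 1 := ⟨s - 1, by ring⟩
  obtain ⟨u, rfl⟩ : ∃ u, a = u + 1 := ⟨a - 1, by ring⟩
  obtain ⟨v, rfl⟩ : ∃ v, b = v + 2 * u + 1 := ⟨b - 1 - 2 * u, by ring⟩
  have ht : 0 < t := by linarith
  have hu : 0 ≤ u := by linarith
  have hv : 0 ≤ v := by linarith
  have hut : u ≤ t := by linarith
  have e : (t + 1) ^ 2 - 1 = t * (t + 2) := by ring
  simp only [e, add_sub_cancel_right]
  have h1 : (u / t) ^ 2 ≤ 1 := by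
    rw [sq_le_one_iff₀ (by positivity)]; exact (div_le_one ht).2 hut
  rw [min_eq_right h1]
  have key : (u / t) ^ 2 + (t * (t + 2) + 2 * u) / (t * (t + 2)) ^ 2 * (v + 2 * u + 1 - (u + 1) ^ 2)
      = ((u * (t + 2)) ^ 2 + (t * (t + 2) + 2 * u) * (v - u ^ 2)) / (t * (t + 2)) ^ 2 := by
    field_simp
    ring
  rw [key]
  set D := t * (t + 2) with hD
  have hDpos : 0 < D := by positivity
  have k2 : 4 * u ^ 2 + (D + 2 * u) * v ≤ (u * (t + 2)) ^ 2 + (D + 2 * u) * (v - u ^ 2) := by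
    have : (u * (t + 2)) ^ 2 + (D + 2 * u) * (v - u ^ 2) - (4 * u ^ 2 + (D + 2 * u) * v)
      = 2 * u ^ 2 * (t - u) := by rw [hD]; ring
    have : 0 ≤ 2 * u ^ 2 * (t - u) := mul_nonneg (by positivity) (by linarith)
    linarith
  rcases le_total (v + 2 * u) D with hc | hc
  · refine (min_le_right _ _).trans ?_
    rw [div_pow]
    refine div_le_div_of_nonneg_right (le_trans ?_ k2) (by positivity)
    nlinarith
  · refine (min_le_left _ _).trans ?_
    rw [one_le_div (by positivity)]
    refine le_trans ?_ k2
    have : 2 * u ≤ D := by rw [hD]; nlinarith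
    nlinarith





/-- Let X_0 > 1 be a real constant and let X_1, ..., X_k be nonnegative real random
variables such that, almost surely, X_{i+1} − 1 ≥ 2(X_i − 1) for every 0 ≤ i < k, and such that
the conditional expectation of X_{i+1} given X_0, ..., X_i is at most X_i^2 almost surely, for
every 0 ≤ i < k. If τ is a real number with τ ≥ 1 + 4(X_0 − 1), then
Pr[X_k ≥ τ^{2^k}] ≤ 48 ((X_0 − 1)/(τ − 1))^2. -/
theorem stmt_8 {Ω : Type*} [MeasurableSpace Ω] (μ : Measure Ω) [IsProbabilityMeasure μ]
    (k : ℕ) (X : ℕ → Ω → ℝ) (x : ℝ) (hx : 1 < x)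
    (hX0 : ∀ ω, X 0 ω = x)
    (hmeas : ∀ i, Measurable (X i))
    (hint : ∀ i, i ≤ k → Integrable (X i) μ)
    (hnonneg : ∀ i, i ≤ k → ∀ᵐ ω ∂μ, 0 ≤ X i ω)
    (hgrow : ∀ i, i < k → ∀ᵐ ω ∂μ, 2 * (X i ω - 1) ≤ X (i + 1) ω - 1)
    (hcond : ∀ i, i < k →
      μ[X (i + 1) |
          MeasurableSpace.comap (fun ω => fun j : Fin (i + 1) => X j ω) inferInstance]
        ≤ᵐ[μ] fun ω => (X i ω) ^ 2)
    (τ : ℝ) (hτ : 1 + 4 * (x - 1) ≤ τ) :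
    (μ {ω | τ ^ (2 ^ k) ≤ X k ω}).toReal ≤ 48 * ((x - 1) / (τ - 1)) ^ 2 := by
  have hx0 : 0 < x - 1 := by linarith
  have hτ1 : 1 < τ := by linarith
  have hs : ∀ i : ℕ, 1 < τ ^ (2 ^ i) := fun i => one_lt_pow₀ hτ1 (by positivity)
  have hge1 : ∀ i, i ≤ k → ∀ᵐ ω ∂μ, 1 ≤ X i ω := by
    intro i
    induction i with
    | zero => intro _; exact Filter.Eventually.of_forall fun ω => by rw [hX0]; exact hx.le
    | succ i ih =>
      intro hi
      filter_upwards [ih (by omega), hgrow i (by omega)] with ω h1 h2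
      linarith
  let φ : ℕ → Ω → ℝ := fun i ω => min 1 (((X i ω - 1) / (τ ^ (2 ^ i) - 1)) ^ 2)
  have hφ0 : ∀ i ω, 0 ≤ φ i ω := fun i ω => le_min zero_le_one (sq_nonneg _)
  have hφ1 : ∀ i ω, φ i ω ≤ 1 := fun i ω => min_le_left _ _
  have hφm : ∀ i, Measurable (φ i) := fun i =>
    measurable_const.min ((((hmeas i).sub_const 1).div_const _).pow_const 2)
  have hφi : ∀ i, Integrable (φ i) μ := fun i =>
    Integrable.of_bound (hφm i).aestronglyMeasurable 1 (Filter.Eventually.of_forall fun ω => by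
      rw [Real.norm_eq_abs, abs_of_nonneg (hφ0 i ω)]; exact hφ1 i ω)
  have hstep : ∀ i, i < k → ∫ ω, φ (i + 1) ω ∂μ ≤ ∫ ω, φ i ω ∂μ := by
    intro i hi
    set s := τ ^ (2 ^ i) with hsdef
    have hs1 : 1 < s := hs i
    have hs2 : τ ^ (2 ^ (i + 1)) = s ^ 2 := by rw [hsdef, ← pow_mul, pow_succ]
    have hs21 : 1 < s ^ 2 := hs2 ▸ hs (i + 1)
    let w : ℝ → ℝ := fun a => (Set.Icc 1 s).indicator
      (fun a => (s ^ 2 - 1 + 2 * (a - 1)) / (s ^ 2 - 1) ^ 2) a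
    have hwm : Measurable w := by
      refine Measurable.indicator ?_ measurableSet_Icc
      fun_prop
    let C : ℝ := (s ^ 2 - 1 + 2 * (s - 1)) / (s ^ 2 - 1) ^ 2
    have hC0 : 0 ≤ C := div_nonneg (by linarith) (by positivity)
    have hw0 : ∀ a, 0 ≤ w a := fun a => by
      refine Set.indicator_nonneg (fun b hb => ?_) a
      exact div_nonneg (by linarith [hb.1]) (by positivity)
    have hwC : ∀ a, w a ≤ C := fun a => by
      refine Set.indicator_le' (fun b hb => ?_) (fun _ _ => hC0) a
      exact div_le_div_of_nonneg_right (by linarith [hb.2]) (by positivity)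
    let V : Ω → (Fin (i + 1) → ℝ) := fun ω => fun j : Fin (i + 1) => X j ω
    have hV : Measurable V := measurable_pi_lambda _ fun j => hmeas j
    have hm : MeasurableSpace.comap V inferInstance ≤ ‹MeasurableSpace Ω› := hV.comap_le
    have hgm : Measurable[MeasurableSpace.comap V inferInstance] (fun ω => w (X i ω)) := by
      have h1 : Measurable (fun v : Fin (i + 1) → ℝ => w (v (Fin.last i))) :=
        hwm.comp (measurable_pi_apply _)
      have h2 := h1.comp (comap_measurable V)
      exact h2
    have hZ : Integrable (fun ω => w (X i ω) * (X i ω) ^ 2) μ := by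
      refine Integrable.of_bound
        ((hwm.comp (hmeas i)).mul ((hmeas i).pow_const 2)).aestronglyMeasurable (C * s ^ 2)
        (Filter.Eventually.of_forall fun ω => ?_)
      rw [Real.norm_eq_abs, abs_of_nonneg (mul_nonneg (hw0 _) (sq_nonneg _))]
      by_cases h : X i ω ∈ Set.Icc 1 s
      · exact mul_le_mul (hwC _) (pow_le_pow_left₀ (by linarith [h.1]) h.2 2) (sq_nonneg _) hC0
      · have : w (X i ω) = 0 := Set.indicator_of_notMem h _
        rw [this, zero_mul]; positivity
    have hY : Integrable (fun ω => w (X i ω) * X (i + 1) ω) μ := by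
      refine (hint (i + 1) hi).bdd_mul (c := C) (hwm.comp (hmeas i)).aestronglyMeasurable
        (Filter.Eventually.of_forall fun ω => ?_)
      rw [Real.norm_eq_abs]
      exact (abs_of_nonneg (hw0 _)).trans_le (hwC _)
    have hle := weighted_condExp_le μ hm (fun ω => w (X i ω)) (X (i + 1)) (fun ω => (X i ω) ^ 2) C
      hgm (fun ω => hw0 _) (fun ω => hwC _) (hint (i + 1) hi) hZ (hcond i hi)
    have hpt : φ (i + 1) ≤ᵐ[μ]
        fun ω => φ i ω + (w (X i ω) * X (i + 1) ω - w (X i ω) * (X i ω) ^ 2) := by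
      filter_upwards [hge1 i hi.le, hgrow i hi] with ω h1 h2
      by_cases h : X i ω ≤ s
      · have e : w (X i ω) = (s ^ 2 - 1 + 2 * (X i ω - 1)) / (s ^ 2 - 1) ^ 2 :=
          Set.indicator_of_mem (show X i ω ∈ Set.Icc 1 s from ⟨h1, h⟩) _
        rw [← mul_sub, e]
        simp only [φ]
        rw [hs2]
        exact pointwise_step _ _ s hs1 h1 h2 h
      · have e : w (X i ω) = 0 := Set.indicator_of_notMem (fun hh => h hh.2) _
        have e2 : φ i ω = 1 := by
          refine min_eq_left ?_
          refine one_le_pow₀ ?_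
          rw [one_le_div (by linarith)]
          linarith [not_le.1 h]
        rw [e, e2]
        linarith [hφ1 (i + 1) ω]
    calc ∫ ω, φ (i + 1) ω ∂μ
        ≤ ∫ ω, (φ i ω + (w (X i ω) * X (i + 1) ω - w (X i ω) * (X i ω) ^ 2)) ∂μ :=
          integral_mono_ae (hφi _) ((hφi i).add (hY.sub hZ)) hpt
      _ = ∫ ω, φ i ω ∂μ
          + (∫ ω, w (X i ω) * X (i + 1) ω ∂μ - ∫ ω, w (X i ω) * (X i ω) ^ 2 ∂μ) := by
          rw [← integral_sub hY hZ]
          exact integral_add (hφi i) (hY.sub hZ)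
      _ ≤ ∫ ω, φ i ω ∂μ := by linarith
  have hall : ∀ i, i ≤ k → ∫ ω, φ i ω ∂μ ≤ ((x - 1) / (τ - 1)) ^ 2 := by
    intro i
    induction i with
    | zero =>
      intro _
      have h : ∀ ω, φ 0 ω ≤ ((x - 1) / (τ - 1)) ^ 2 := fun ω => by
        refine (min_le_right _ _).trans ?_
        rw [hX0]; simp
      calc ∫ ω, φ 0 ω ∂μ ≤ ∫ _, ((x - 1) / (τ - 1)) ^ 2 ∂μ :=
            integral_mono (hφi 0) (integrable_const _) h
        _ = _ := by simp
    | succ i ih => intro hi; exact (hstep i hi).trans (ih (by omega))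
  have hS : MeasurableSet {ω | τ ^ (2 ^ k) ≤ X k ω} := measurableSet_le measurable_const (hmeas k)
  have hfin : (μ {ω | τ ^ (2 ^ k) ≤ X k ω}).toReal ≤ ∫ ω, φ k ω ∂μ := by
    have e : (μ {ω | τ ^ (2 ^ k) ≤ X k ω}).toReal
        = ∫ ω, {ω | τ ^ (2 ^ k) ≤ X k ω}.indicator (1 : Ω → ℝ) ω ∂μ :=
      (integral_indicator_one hS).symm
    rw [e]
    refine integral_mono ((integrable_const (1 : ℝ)).indicator hS) (hφi k) fun ω => ?_
    refine Set.indicator_le' (f := (1 : Ω → ℝ)) (g := φ k) (fun ω hω => ?_)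
      (fun ω _ => hφ0 k ω) ω
    refine le_min le_rfl (one_le_pow₀ ?_)
    rw [one_le_div (by linarith [hs k])]
    linarith [show τ ^ (2 ^ k) ≤ X k ω from hω]
  have := hall k le_rfl
  have := sq_nonneg ((x - 1) / (τ - 1))
  linarith
end

section
/- There exist absolute constants C_0 > 0, D_0 > 0 and ℓ_0 such that the following holds. Let U ≥ ℓ ≥ ℓ_0, let S ⊆ F_2^U have size 2^ℓ, and let H : F_2^U → F_2^ℓ be chosen uniformly at random from the set of all surjective F_2-linear maps from F_2^U to F_2^ℓ. Then for every real R > 1 satisfying R ℓ^{1 − 1/R} ≥ D_0 ln ℓ, one has Pr[M(S,H) ≥ R ℓ / log_2 ℓ] ≤ C_0 (ln ℓ)^2 / (R^2 ℓ^{2 − 2/R}). -/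
/-- The space of F_2-linear maps from F_2^U to F_2^ℓ. -/
abbrev Lin (U ℓ : ℕ) := (Fin U → ZMod 2) →ₗ[ZMod 2] (Fin ℓ → ZMod 2)

/-- The maximum load M(S,H) = max_{y ∈ F_2^ℓ} |H^{-1}(y) ∩ S|. -/
def maxLoad (U ℓ : ℕ) (S : Finset (Fin U → ZMod 2)) (H : Lin U ℓ) : ℕ :=
  Finset.univ.sup fun y : Fin ℓ → ZMod 2 => (S.filter fun v => H v = y).card

theorem q_deriv_aux (u d : ℝ) (hu : 0 ≤ u) (hd : 0 ≤ d) :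
    3 * (u + d) ^ 2 + 6 * (u + d) + 6 ≤ (3 * u ^ 2 + 6 * u + 6) * Real.exp d := by
  have h1 := Real.quadratic_le_exp_of_nonneg hd
  have h2 : (3 * u ^ 2 + 6 * u + 6) * (1 + d + d ^ 2 / 2) ≤ (3 * u ^ 2 + 6 * u + 6) * Real.exp d :=
    mul_le_mul_of_nonneg_left h1 (by positivity)
  have h3 : 0 ≤ u ^ 2 * d := by positivity
  have h4 : 0 ≤ u ^ 2 * d ^ 2 := by positivity
  have h5 : 0 ≤ u * d ^ 2 := by positivity
  nlinarith

theorem q_tangent (a u : ℝ) (ha : 0 ≤ a) (hu : 0 ≤ u) :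
    u ^ 3 + 3 * u ^ 2 + 6 * u ≤
      a ^ 3 + 3 * a ^ 2 + 6 * a + (3 * a ^ 2 + 6 * a + 6) * (Real.exp (u - a) - 1) := by
  set h : ℝ → ℝ := fun u => (3 * a ^ 2 + 6 * a + 6) * (Real.exp (u - a) - 1)
    - (u ^ 3 + 3 * u ^ 2 + 6 * u) with hh
  have hder : ∀ x, HasDerivAt h ((3 * a ^ 2 + 6 * a + 6) * Real.exp (x - a)
      - (3 * x ^ 2 + 6 * x + 6)) x := by
    intro x
    have e1 : HasDerivAt (fun u => Real.exp (u - a)) (Real.exp (x - a) * 1) x :=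
      ((hasDerivAt_id x).sub_const a).exp
    have e2 := (e1.sub_const 1).const_mul (3 * a ^ 2 + 6 * a + 6)
    have e3 := ((hasDerivAt_pow 3 x).add ((hasDerivAt_pow 2 x).const_mul 3)).add
      ((hasDerivAt_id x).const_mul 6)
    refine (e2.sub e3).congr_deriv ?_
    norm_num
    ring
  have hcont : Continuous h := by
    rw [hh]; fun_prop
  have key : h a ≤ h u := by
    rcases le_total a u with hau | hau
    · refine monotoneOn_of_deriv_nonneg (convex_Ici a) hcont.continuousOn
        (fun x _ => (hder x).differentiableAt.differentiableWithinAt) ?_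
        (Set.mem_Ici.2 le_rfl) (Set.mem_Ici.2 hau) hau
      intro x hx
      rw [interior_Ici, Set.mem_Ioi] at hx
      rw [(hder x).deriv]
      have := q_deriv_aux a (x - a) ha (by linarith)
      rw [show a + (x - a) = x by ring] at this
      linarith
    · refine antitoneOn_of_deriv_nonpos (convex_Icc 0 a) hcont.continuousOn
        (fun x _ => (hder x).differentiableAt.differentiableWithinAt) ?_
        (Set.mem_Icc.2 ⟨hu, hau⟩) (Set.mem_Icc.2 ⟨ha, le_rfl⟩) hau
      intro x hx
      rw [interior_Icc, Set.mem_Ioo] at hx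
      rw [(hder x).deriv]
      have := q_deriv_aux x (a - x) hx.1.le (by linarith [hx.2])
      rw [show x + (a - x) = a by ring] at this
      have h2 := mul_le_mul_of_nonneg_right this (Real.exp_pos (x - a)).le
      rw [mul_assoc, ← Real.exp_add, show a - x + (x - a) = 0 by ring, Real.exp_zero] at h2
      linarith
  simp only [hh, sub_self, Real.exp_zero] at key
  linarith

/-- the cubic potential -/
theorem p_tangent (s a u : ℝ) (hs : 0 < s) (ha : 0 ≤ a) (hu : 0 ≤ u) :
    u ^ 3 + 3 * s * u ^ 2 + 6 * s ^ 2 * u ≤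
      a ^ 3 + 3 * s * a ^ 2 + 6 * s ^ 2 * a
        + s * (3 * a ^ 2 + 6 * s * a + 6 * s ^ 2) * (Real.exp ((u - a) / s) - 1) := by
  have := q_tangent (a / s) (u / s) (by positivity) (by positivity)
  have h2 := mul_le_mul_of_nonneg_left this (show 0 ≤ s ^ 3 by positivity)
  rw [← sub_div] at h2
  generalize Real.exp ((u - a) / s) = X at h2 ⊢
  have e1 : s ^ 3 * ((u / s) ^ 3 + 3 * (u / s) ^ 2 + 6 * (u / s)) =
      u ^ 3 + 3 * s * u ^ 2 + 6 * s ^ 2 * u := by field_simp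
  have e2 : s ^ 3 * ((a / s) ^ 3 + 3 * (a / s) ^ 2 + 6 * (a / s)
      + (3 * (a / s) ^ 2 + 6 * (a / s) + 6) * (X - 1)) =
      a ^ 3 + 3 * s * a ^ 2 + 6 * s ^ 2 * a
        + s * (3 * a ^ 2 + 6 * s * a + 6 * s ^ 2) * (X - 1) := by field_simp
  linarith

theorem sum_hom {G G' : Type*} [AddCommGroup G] [AddCommGroup G'] [Fintype G] [Fintype G']
    (φ : G →+ G') (h : Function.Surjective φ) (F : G' → ℝ) :
    (∑ g, F (φ g)) / (Fintype.card G : ℝ) = (∑ y, F y) / (Fintype.card G' : ℝ) := by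
  classical
  obtain ⟨c, hc⟩ : ∃ c : ℕ, ∀ y, (Finset.univ.filter fun g => φ g = y).card = c :=
    ⟨_, fun y => AddMonoidHom.card_fiber_eq_of_mem_range φ (h y) (h 0)⟩
  have key : ∀ F : G' → ℝ, ∑ g, F (φ g) = c * ∑ y, F y := by
    intro F
    rw [← Finset.sum_fiberwise Finset.univ φ, Finset.mul_sum]
    refine Finset.sum_congr rfl fun y _ => ?_
    rw [Finset.sum_congr rfl (g := fun _ => F y), Finset.sum_const, hc, nsmul_eq_mul]
    intro x hx
    rw [(Finset.mem_filter.1 hx).2]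
  have h1 := key fun _ => 1
  simp only [Finset.sum_const, Finset.card_univ, nsmul_eq_mul, mul_one] at h1
  rw [key F, h1]
  have hG : (Fintype.card G : ℝ) ≠ 0 := by exact_mod_cast Fintype.card_ne_zero
  have : (c : ℝ) ≠ 0 := by
    intro h0; rw [h0, zero_mul] at h1; exact hG h1
  rw [mul_div_mul_left _ _ this]

noncomputable instance linFintype (U m : ℕ) : Fintype (Lin U m) :=
  Fintype.ofInjective (fun H : Lin U m => (H : (Fin U → ZMod 2) → (Fin m → ZMod 2)))
    DFunLike.coe_injective

theorem card_vec (m : ℕ) : Fintype.card (Fin m → ZMod 2) = 2 ^ m := by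
  simp [ZMod.card]

theorem exists_quot (m : ℕ) (v : Fin (m + 1) → ZMod 2) (hv : v ≠ 0) :
    ∃ T : Lin (m + 1) m, Function.Surjective T ∧ ∀ x, T x = 0 ↔ x = 0 ∨ x = v := by
  have hfin : Module.finrank (ZMod 2) ((Fin (m + 1) → ZMod 2) ⧸ (ZMod 2 ∙ v))
      = Module.finrank (ZMod 2) (Fin m → ZMod 2) := by
    have h1 := Submodule.finrank_quotient_add_finrank (ZMod 2 ∙ v)
    rw [finrank_span_singleton hv] at h1
    simp at h1 ⊢
    omega
  let e := LinearEquiv.ofFinrankEq _ _ hfin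
  refine ⟨e.toLinearMap.comp (Submodule.mkQ (ZMod 2 ∙ v)), ?_, ?_⟩
  · rw [LinearMap.coe_comp]
    exact e.surjective.comp (Submodule.mkQ_surjective _)
  · intro x
    simp only [LinearMap.coe_comp, LinearEquiv.coe_coe, Function.comp_apply,
      EmbeddingLike.map_eq_zero_iff, Submodule.mkQ_apply, Submodule.Quotient.mk_eq_zero,
      Submodule.mem_span_singleton]
    constructor
    · rintro ⟨a, rfl⟩
      fin_cases a
      · left; exact zero_smul _ _
      · right; exact one_smul _ _
    · rintro (rfl | rfl)
      · exact ⟨0, by simp⟩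
      · exact ⟨1, by simp⟩

/-- nonzero vectors -/
abbrev NZ (m : ℕ) := {v : Fin m → ZMod 2 // v ≠ 0}

/-- quotient map by a nonzero vector -/
noncomputable def quo (m : ℕ) (v : NZ (m + 1)) : Lin (m + 1) m :=
  (exists_quot m v.1 v.2).choose

theorem quo_surj (m : ℕ) (v : NZ (m + 1)) : Function.Surjective (quo m v) :=
  (exists_quot m v.1 v.2).choose_spec.1

theorem quo_zero (m : ℕ) (v : NZ (m + 1)) (x) : quo m v x = 0 ↔ x = 0 ∨ x = v.1 :=
  (exists_quot m v.1 v.2).choose_spec.2 x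

theorem quo_eq (m : ℕ) (v : NZ (m + 1)) (x y) : quo m v x = quo m v y ↔ x = y ∨ x = y + v.1 := by
  rw [← sub_eq_zero, ← map_sub, quo_zero, sub_eq_zero, sub_eq_iff_eq_add, add_comm v.1]

/-- load of a bin -/
def load {U m : ℕ} (S : Finset (Fin U → ZMod 2)) (H : Lin U m) (y : Fin m → ZMod 2) : ℕ :=
  (S.filter fun v => H v = y).card

theorem load_quo {U m : ℕ} (S : Finset (Fin U → ZMod 2)) (H : Lin U (m + 1)) (v : NZ (m + 1)) (x) :
    load S ((quo m v).comp H) (quo m v x) = load S H x + load S H (x + v.1) := by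
  unfold load
  rw [← Finset.card_union_of_disjoint]
  · congr 1
    ext a
    simp only [LinearMap.coe_comp, Function.comp_apply, Finset.mem_filter, Finset.mem_union, quo_eq]
    tauto
  · rw [Finset.disjoint_filter]
    intro a _ h1 h2
    rw [h1] at h2
    exact v.2 (by simpa using h2)

theorem sum_load {U m : ℕ} (S : Finset (Fin U → ZMod 2)) (H : Lin U m) :
    ∑ y, load S H y = S.card := by
  unfold load
  rw [← Finset.card_eq_sum_card_fiberwise]
  intro x _; simp

/-- exponential average -/
noncomputable def Aa {U m : ℕ} (S : Finset (Fin U → ZMod 2)) (z : ℝ) (H : Lin U m) : ℝ :=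
  (∑ y, z ^ load S H y) / 2 ^ m

/-- rescaled logarithm -/
noncomputable def Yy {U m : ℕ} (S : Finset (Fin U → ZMod 2)) (z : ℝ) (H : Lin U m) : ℝ :=
  2 ^ m * Real.log (Aa S z H)

theorem Aa_ge {U m : ℕ} (S : Finset (Fin U → ZMod 2)) (z : ℝ) (hz : 1 ≤ z) (H : Lin U m) :
    1 + S.card * (z - 1) / 2 ^ m ≤ Aa S z H := by
  have h1 : ∑ y : Fin m → ZMod 2, (1 + (load S H y : ℝ) * (z - 1)) ≤ ∑ y, z ^ load S H y := by
    refine Finset.sum_le_sum fun y _ => ?_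
    have := one_add_mul_le_pow (a := z - 1) (by linarith) (load S H y)
    simpa using this
  rw [Finset.sum_add_distrib, ← Finset.sum_mul, ← Nat.cast_sum, sum_load] at h1
  simp only [Finset.sum_const, Finset.card_univ, card_vec, nsmul_eq_mul, mul_one, Nat.cast_pow,
    Nat.cast_ofNat] at h1
  unfold Aa
  rw [le_div_iff₀ (by positivity), add_mul, div_mul_cancel₀ _ (by positivity), one_mul]
  exact h1

theorem Aa_ge_one {U m : ℕ} (S : Finset (Fin U → ZMod 2)) (z : ℝ) (hz : 1 ≤ z) (H : Lin U m) :
    1 ≤ Aa S z H := by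
  refine le_trans ?_ (Aa_ge S z hz H)
  have : 0 ≤ S.card * (z - 1) / 2 ^ m := by
    have : 0 ≤ z - 1 := by linarith
    positivity
  linarith

theorem Yy_nonneg {U m : ℕ} (S : Finset (Fin U → ZMod 2)) (z : ℝ) (hz : 1 ≤ z) (H : Lin U m) :
    0 ≤ Yy S z H :=
  mul_nonneg (by positivity) (Real.log_nonneg (Aa_ge_one S z hz H))

theorem Yy_ge {U m : ℕ} (S : Finset (Fin U → ZMod 2)) (z : ℝ) (hz : 1 ≤ z) (H : Lin U m) :
    S.card * (z - 1) - (S.card * (z - 1)) ^ 2 / (2 * 2 ^ m) ≤ Yy S z H := by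
  have hw : 0 ≤ S.card * (z - 1) := by
    have : 0 ≤ z - 1 := by linarith
    positivity
  have h1 := Aa_ge S z hz H
  set w := S.card * (z - 1)
  unfold Yy
  have h0 : (0:ℝ) < 2 ^ m := by positivity
  have hx : 0 ≤ w / 2 ^ m := by positivity
  have h2 : Real.log (1 + w / 2 ^ m) ≤ Real.log (Aa S z H) := Real.log_le_log (by positivity) h1
  have h3 := Real.le_log_one_add_of_nonneg hx
  have h4 : w / 2 ^ m - (w / 2 ^ m) ^ 2 / 2 ≤ 2 * (w / 2 ^ m) / (w / 2 ^ m + 2) := by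
    rw [le_div_iff₀ (by positivity)]
    have : 0 ≤ (w / 2 ^ m) ^ 3 := by positivity
    nlinarith
  have h5 := mul_le_mul_of_nonneg_left (h4.trans (h3.trans h2)) h0.le
  refine le_trans (le_of_eq ?_) h5
  field_simp

theorem autocorr {m : ℕ} (g : (Fin m → ZMod 2) → ℝ) :
    (∑ v : NZ m, ∑ x, g x * g (x + v.1)) * 2 ^ m ≤ (2 ^ m - 1) * (∑ x, g x) ^ 2 := by
  have hall : ∑ v : Fin m → ZMod 2, ∑ x, g x * g (x + v) = (∑ x, g x) ^ 2 := by
    rw [Finset.sum_comm, sq, Finset.sum_mul]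
    refine Finset.sum_congr rfl fun x _ => ?_
    rw [← Finset.mul_sum]
    congr 1
    exact Equiv.sum_comp (Equiv.addLeft x) g
  have hsplit : ∑ v : Fin m → ZMod 2, ∑ x, g x * g (x + v) =
      (∑ v : NZ m, ∑ x, g x * g (x + v.1)) + ∑ x, g x * g x := by
    rw [← Finset.sum_erase_add _ _ (Finset.mem_univ (0 : Fin m → ZMod 2))]
    congr 1
    · symm
      refine Finset.sum_bij (fun v _ => v.1) ?_ ?_ ?_ ?_
      · intro v _; simp [v.2]
      · intro a _ b _ h; exact Subtype.ext h
      · intro b hb; exact ⟨⟨b, (Finset.mem_erase.1 hb).1⟩, Finset.mem_univ _, rfl⟩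
      · intro v _; rfl
    · simp
  have hle : ∀ v : NZ m, ∑ x, g x * g (x + v.1) ≤ ∑ x, g x * g x := by
    intro v
    have e : ∑ x, g (x + v.1) * g (x + v.1) = ∑ x, g x * g x :=
      Equiv.sum_comp (Equiv.addRight v.1) (fun x => g x * g x)
    have : ∑ x, g x * g (x + v.1) ≤ ∑ x, (g x * g x + g (x + v.1) * g (x + v.1)) / 2 := by
      refine Finset.sum_le_sum fun x _ => ?_
      nlinarith [sq_nonneg (g x - g (x + v.1))]
    rw [← Finset.sum_div, Finset.sum_add_distrib, e] at this
    linarith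
  have hcard : (Fintype.card (NZ m) : ℝ) = 2 ^ m - 1 := by
    have : Fintype.card (NZ m) = 2 ^ m - 1 := by
      rw [Fintype.card_subtype_compl, card_vec]; simp
    rw [this, Nat.cast_sub Nat.one_le_two_pow]; simp
  have hsum := Finset.sum_le_sum (s := Finset.univ) fun v (_ : v ∈ Finset.univ) => hle v
  rw [Finset.sum_const, Finset.card_univ, nsmul_eq_mul, hcard] at hsum
  rw [← hall, hsplit]
  nlinarith

/-- average over nonzero vectors -/
noncomputable def avNZ {m : ℕ} (F : NZ m → ℝ) : ℝ := (∑ v, F v) / (Fintype.card (NZ m) : ℝ)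

/-- average over all linear maps -/
noncomputable def avL {U m : ℕ} (F : Lin U m → ℝ) : ℝ := (∑ H, F H) / (Fintype.card (Lin U m) : ℝ)

theorem card_NZ (m : ℕ) : (Fintype.card (NZ m) : ℝ) = 2 ^ m - 1 := by
  have : Fintype.card (NZ m) = 2 ^ m - 1 := by
    rw [Fintype.card_subtype_compl, card_vec]; simp
  rw [this, Nat.cast_sub Nat.one_le_two_pow]; simp

theorem card_NZ_pos (m : ℕ) : 0 < (Fintype.card (NZ (m + 1)) : ℝ) := by
  rw [card_NZ]
  have : (1:ℝ) ≤ 2 ^ m := one_le_pow₀ (by norm_num)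
  rw [pow_succ]; linarith

theorem Aa_quo {U m : ℕ} (S : Finset (Fin U → ZMod 2)) (z : ℝ) (H : Lin U (m + 1)) (v : NZ (m + 1)) :
    Aa S z ((quo m v).comp H) = (∑ x, z ^ load S H x * z ^ load S H (x + v.1)) / 2 ^ (m + 1) := by
  have := sum_hom (quo m v).toAddMonoidHom (quo_surj m v)
    (fun y => z ^ load S ((quo m v).comp H) y)
  rw [card_vec, card_vec] at this
  push_cast at this
  unfold Aa
  rw [← this]
  congr 1
  refine Finset.sum_congr rfl fun x _ => ?_
  rw [← pow_add, ← load_quo]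
  rfl

theorem Aa_step {U m : ℕ} (S : Finset (Fin U → ZMod 2)) (z : ℝ) (H : Lin U (m + 1)) :
    avNZ (fun v => Aa S z ((quo m v).comp H)) ≤ Aa S z H ^ 2 := by
  unfold avNZ
  rw [div_le_iff₀ (card_NZ_pos m), card_NZ]
  simp only [Aa_quo]
  rw [← Finset.sum_div]
  have := autocorr (fun x => z ^ load S H x)
  unfold Aa
  rw [div_le_iff₀ (by positivity), div_pow]
  have h0 : (0:ℝ) < 2 ^ (m + 1) := by positivity
  rw [div_mul_eq_mul_div, div_mul_eq_mul_div, le_div_iff₀ (by positivity)]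
  nlinarith

theorem avNZ_mono {m : ℕ} {F G : NZ m → ℝ} (h : ∀ v, F v ≤ G v) : avNZ F ≤ avNZ G :=
  div_le_div_of_nonneg_right (Finset.sum_le_sum fun v _ => h v) (by positivity)

theorem avL_mono {U m : ℕ} {F G : Lin U m → ℝ} (h : ∀ v, F v ≤ G v) : avL F ≤ avL G :=
  div_le_div_of_nonneg_right (Finset.sum_le_sum fun v _ => h v) (by positivity)

theorem avNZ_affine {m : ℕ} (F : NZ (m + 1) → ℝ) (a b : ℝ) :
    avNZ (fun v => a + b * F v) = a + b * avNZ F := by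
  unfold avNZ
  rw [Finset.sum_add_distrib, ← Finset.mul_sum, Finset.sum_const, Finset.card_univ, nsmul_eq_mul]
  have := (card_NZ_pos m).ne'
  field_simp

theorem avL_affine {U m : ℕ} (F : Lin U m → ℝ) (a b : ℝ) :
    avL (fun v => a + b * F v) = a + b * avL F := by
  unfold avL
  rw [Finset.sum_add_distrib, ← Finset.mul_sum, Finset.sum_const, Finset.card_univ, nsmul_eq_mul]
  have : (Fintype.card (Lin U m) : ℝ) ≠ 0 := by exact_mod_cast Fintype.card_ne_zero
  field_simp

theorem exp_step {U m : ℕ} (S : Finset (Fin U → ZMod 2)) (z : ℝ) (hz : 1 ≤ z) (H : Lin U (m + 1)) :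
    avNZ (fun v => Real.exp ((Yy S z ((quo m v).comp H) - Yy S z H) / 2 ^ m)) ≤ 1 := by
  have hA : 0 < Aa S z H := by linarith [Aa_ge_one S z hz H]
  have e : ∀ v : NZ (m + 1), Real.exp ((Yy S z ((quo m v).comp H) - Yy S z H) / 2 ^ m) =
      0 + (1 / Aa S z H ^ 2) * Aa S z ((quo m v).comp H) := by
    intro v
    have hA' : 0 < Aa S z ((quo m v).comp H) := by linarith [Aa_ge_one S z hz ((quo m v).comp H)]
    unfold Yy
    have : (2 ^ m * Real.log (Aa S z ((quo m v).comp H)) - 2 ^ (m + 1) * Real.log (Aa S z H)) / 2 ^ m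
        = Real.log (Aa S z ((quo m v).comp H)) - Real.log (Aa S z H ^ 2) := by
      rw [Real.log_pow, pow_succ]; field_simp; push_cast; ring
    rw [this, Real.exp_sub, Real.exp_log hA', Real.exp_log (by positivity)]
    ring
  simp only [e]
  rw [avNZ_affine, zero_add, one_div_mul_eq_div, div_le_one (by positivity)]
  exact Aa_step S z H

theorem avL_quo {U m : ℕ} (F : Lin U m → ℝ) :
    avL (fun H : Lin U (m + 1) => avNZ fun v => F ((quo m v).comp H)) = avL F := by
  have h1 : ∀ v : NZ (m + 1), (∑ H : Lin U (m + 1), F ((quo m v).comp H)) /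
      (Fintype.card (Lin U (m + 1)) : ℝ) = avL F := by
    intro v
    obtain ⟨g, hg⟩ := LinearMap.exists_rightInverse_of_surjective (quo m v)
      (LinearMap.range_eq_top.2 (quo_surj m v))
    exact sum_hom (G := Lin U (m + 1)) (G' := Lin U m)
      { toFun := fun H => (quo m v).comp H
        map_zero' := by simp
        map_add' := fun a b => LinearMap.comp_add _ _ _ }
      (fun H => ⟨g.comp H, by
        show (quo m v).comp (g.comp H) = H
        rw [← LinearMap.comp_assoc, hg, LinearMap.id_comp]⟩) F
  have h2 : avL (fun H : Lin U (m + 1) => avNZ fun v => F ((quo m v).comp H)) =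
      avNZ (fun v : NZ (m + 1) => (∑ H : Lin U (m + 1), F ((quo m v).comp H)) /
      (Fintype.card (Lin U (m + 1)) : ℝ)) := by
    unfold avNZ avL
    rw [← Finset.sum_div, ← Finset.sum_div, Finset.sum_comm, div_right_comm]
  rw [h2]
  simp only [h1]
  have := avNZ_affine (m := m) (fun _ => avL F) (avL F) 0
  simpa using this

theorem avY_mono {U m : ℕ} (S : Finset (Fin U → ZMod 2)) (z : ℝ) (hz : 1 ≤ z) :
    avL (fun H : Lin U m => Yy S z H) ≤ avL (fun H : Lin U (m + 1) => Yy S z H) := by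
  rw [← avL_quo]
  refine avL_mono fun H => ?_
  have h0 : (0:ℝ) < 2 ^ m := by positivity
  have h1 : avNZ (fun v => Yy S z ((quo m v).comp H)) ≤ avNZ (fun v => (Yy S z H - 2 ^ m) +
      2 ^ m * Real.exp ((Yy S z ((quo m v).comp H) - Yy S z H) / 2 ^ m)) := by
    refine avNZ_mono fun v => ?_
    have := Real.add_one_le_exp ((Yy S z ((quo m v).comp H) - Yy S z H) / 2 ^ m)
    have := mul_le_mul_of_nonneg_left this h0.le
    rw [mul_add, mul_div_cancel₀ _ h0.ne'] at this
    linarith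
  rw [avNZ_affine] at h1
  have h2 := mul_le_mul_of_nonneg_left (exp_step S z hz H) h0.le
  linarith

theorem avY_mono' {U m : ℕ} (S : Finset (Fin U → ZMod 2)) (z : ℝ) (hz : 1 ≤ z) (k : ℕ) :
    avL (fun H : Lin U m => Yy S z H) ≤ avL (fun H : Lin U (m + k) => Yy S z H) := by
  induction k with
  | zero => exact le_rfl
  | succ k ih => exact ih.trans (avY_mono S z hz)

theorem avL_coll {U m : ℕ} (v : Fin U → ZMod 2) (hv : v ≠ 0) (c : ℝ) :
    avL (fun H : Lin U m => if H v = 0 then c else 0) = c / 2 ^ m := by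
  obtain ⟨i, hi⟩ : ∃ i, v i ≠ 0 := by
    by_contra! h
    exact hv (funext h)
  have := sum_hom (G := Lin U m) (G' := Fin m → ZMod 2)
    { toFun := fun H => H v
      map_zero' := by simp
      map_add' := fun a b => LinearMap.add_apply _ _ _ }
    (fun y => ⟨(LinearMap.proj i : (Fin U → ZMod 2) →ₗ[ZMod 2] ZMod 2).smulRight ((v i)⁻¹ • y), by
        show v i • ((v i)⁻¹ • y) = y
        rw [smul_smul, mul_inv_cancel₀ hi, one_smul]⟩) (fun y => if y = 0 then c else 0)
  rw [card_vec] at this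
  simp only [AddMonoidHom.coe_mk, ZeroHom.coe_mk, Finset.sum_ite_eq', Finset.mem_univ,
    if_true] at this
  push_cast at this
  exact this

theorem Yy_top {U m : ℕ} (S : Finset (Fin U → ZMod 2)) (z : ℝ) (hz : 1 ≤ z) (H : Lin U m) :
    Yy S z H ≤ S.card * (z - 1) + ∑ p ∈ S.offDiag,
      if H (p.1 - p.2) = 0 then S.card * z ^ S.card else 0 := by
  have h0 : (0:ℝ) < 2 ^ m := by positivity
  have hA := Aa_ge_one S z hz H
  have h1 : Yy S z H ≤ ∑ y, (z ^ load S H y - 1) := by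
    have := Real.log_le_sub_one_of_pos (lt_of_lt_of_le one_pos hA)
    have := mul_le_mul_of_nonneg_left this h0.le
    refine this.trans (le_of_eq ?_)
    unfold Aa
    rw [mul_sub, mul_div_cancel₀ _ h0.ne', Finset.sum_sub_distrib]
    simp
  have hterm : ∀ p ∈ S.offDiag, (0:ℝ) ≤ if H (p.1 - p.2) = 0 then S.card * z ^ S.card else 0 := by
    intro p _
    split_ifs
    · positivity
    · exact le_rfl
  have hsl : ∑ y, (load S H y : ℝ) = S.card := by rw [← Nat.cast_sum, sum_load]
  refine h1.trans ?_
  by_cases hinj : ∃ p ∈ S.offDiag, H (p.1 - p.2) = 0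
  · obtain ⟨p, hp, hHp⟩ := hinj
    have h2 := Finset.single_le_sum hterm hp
    rw [if_pos hHp] at h2
    have h3 : ∑ y, (z ^ load S H y - 1) ≤ ∑ y, (load S H y : ℝ) * z ^ S.card := by
      refine Finset.sum_le_sum fun y _ => ?_
      have hl : load S H y ≤ S.card := Finset.card_filter_le _ _
      rcases Nat.eq_zero_or_pos (load S H y) with h | h
      · simp [h]
      · have h4 : z ^ load S H y ≤ z ^ S.card := pow_le_pow_right₀ hz hl
        have h5 : (1:ℝ) ≤ load S H y := by exact_mod_cast h
        have h6 : 0 ≤ z ^ S.card := by positivity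
        nlinarith
    rw [← Finset.sum_mul, hsl] at h3
    have : 0 ≤ S.card * (z - 1) := mul_nonneg (by positivity) (by linarith)
    linarith
  · push Not at hinj
    have h3 : ∑ y, (z ^ load S H y - 1) ≤ ∑ y, (load S H y : ℝ) * (z - 1) := by
      refine Finset.sum_le_sum fun y _ => ?_
      have hl : load S H y ≤ 1 := by
        unfold load
        rw [Finset.card_le_one]
        intro a ha b hb
        by_contra hab
        rw [Finset.mem_filter] at ha hb
        refine hinj (a, b) (Finset.mem_offDiag.2 ⟨ha.1, hb.1, hab⟩) ?_
        simp [ha.2, hb.2]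
      interval_cases load S H y <;> simp
    rw [← Finset.sum_mul, hsl] at h3
    have := Finset.sum_nonneg hterm
    linarith

theorem avY_le {U m : ℕ} (S : Finset (Fin U → ZMod 2)) (z : ℝ) (hz : 1 ≤ z) :
    avL (fun H : Lin U m => Yy S z H) ≤ S.card * (z - 1) := by
  set B : ℝ := S.offDiag.card * (S.card * z ^ S.card) with hB
  have hbd : ∀ k : ℕ, avL (fun H : Lin U m => Yy S z H) ≤ S.card * (z - 1) + B * (1 / 2 ^ (m + k)) := by
    intro k
    refine (avY_mono' S z hz k).trans ((avL_mono fun H => Yy_top S z hz H).trans (le_of_eq ?_))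
    have := avL_affine (U := U) (m := m + k) (fun H : Lin U (m + k) => ∑ p ∈ S.offDiag,
      if H (p.1 - p.2) = 0 then (S.card : ℝ) * z ^ S.card else 0) (S.card * (z - 1)) 1
    simp only [one_mul] at this
    rw [this]
    congr 1
    unfold avL
    rw [Finset.sum_comm, Finset.sum_div, hB, mul_assoc]
    have hc : ∀ p ∈ S.offDiag, (∑ H : Lin U (m + k),
        if H (p.1 - p.2) = 0 then (S.card : ℝ) * z ^ S.card else 0) /
          (Fintype.card (Lin U (m + k)) : ℝ) = S.card * z ^ S.card * (1 / 2 ^ (m + k)) := by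
      intro p hp
      rw [mul_one_div]
      exact avL_coll _ (sub_ne_zero.2 (Finset.mem_offDiag.1 hp).2.2) _
    rw [Finset.sum_congr rfl hc, Finset.sum_const, nsmul_eq_mul]
  have hlim : Filter.Tendsto (fun k : ℕ => S.card * (z - 1) + B * (1 / 2 ^ (m + k)))
      Filter.atTop (nhds (S.card * (z - 1) + B * 0)) := by
    refine Filter.Tendsto.const_add _ (Filter.Tendsto.const_mul _ ?_)
    have h1 := tendsto_pow_atTop_nhds_zero_of_lt_one (r := (1/2 : ℝ)) (by norm_num) (by norm_num)
    have h2 := h1.comp (Filter.tendsto_add_atTop_nat m)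
    refine h2.congr fun k => ?_
    simp [add_comm]
  have := ge_of_tendsto' hlim hbd
  simpa using this

/-- iterated averaging -/
noncomputable def Kit {U ℓ : ℕ} (Ψ : Lin U ℓ → ℝ) : (k : ℕ) → Lin U (ℓ + k) → ℝ
  | 0 => Ψ
  | k + 1 => fun H => avNZ fun v : NZ (ℓ + k + 1) => Kit Ψ k ((quo (ℓ + k) v).comp H)

theorem avL_Kit {U ℓ : ℕ} (Ψ : Lin U ℓ → ℝ) (k : ℕ) : avL (Kit Ψ k) = avL Ψ := by
  induction k with
  | zero => rfl
  | succ k ih =>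
    rw [← ih]
    exact avL_quo (Kit Ψ k)

theorem Kit_le_one {U ℓ : ℕ} (Ψ : Lin U ℓ → ℝ) (h : ∀ H, Ψ H ≤ 1) (k : ℕ) (H) :
    Kit Ψ k H ≤ 1 := by
  induction k with
  | zero => exact h H
  | succ k ih =>
    have h1 : Kit Ψ (k + 1) H ≤ avNZ (fun v : NZ (ℓ + k + 1) => 1 + 0 * 0) := by
      refine avNZ_mono fun v => ?_
      simpa using ih _
    rw [avNZ_affine] at h1
    linarith

theorem Kit_le {U ℓ : ℕ} (S : Finset (Fin U → ZMod 2)) (z : ℝ) (hz : 1 ≤ z) (c : ℝ) (w : ℝ)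
    (hw : w = S.card * (z - 1)) (Ψ : Lin U ℓ → ℝ)
    (h : ∀ H, c * Ψ H ≤ Yy S z H ^ 3 + 3 * 2 ^ ℓ * Yy S z H ^ 2 + 6 * (2 ^ ℓ) ^ 2 * Yy S z H)
    (k : ℕ) (H : Lin U (ℓ + k)) :
    c * Kit Ψ k H ≤ Yy S z H ^ 3 + 3 * 2 ^ (ℓ + k) * Yy S z H ^ 2
      + 6 * (2 ^ (ℓ + k)) ^ 2 * Yy S z H
      - (6 * w * ((2 ^ (ℓ + k)) ^ 2 - (2 ^ ℓ) ^ 2) - 9 / 2 * w ^ 2 * (2 ^ (ℓ + k) - 2 ^ ℓ)) := by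
  induction k with
  | zero =>
    have := h H
    simp only [Kit, Nat.add_zero, sub_self, mul_zero, sub_zero]
    exact this
  | succ k ih =>
    have hY := Yy_nonneg S z hz H
    have hYge := Yy_ge S z hz H
    have hs : (0:ℝ) < 2 ^ (ℓ + k) := by positivity
    have hexp := exp_step S z hz (m := ℓ + k) H
    rw [← hw] at hYge
    rw [show (2:ℝ) ^ (ℓ + (k + 1)) = 2 * 2 ^ (ℓ + k) by rw [← add_assoc, pow_succ]; ring] at hYge ⊢
    set γ := (6 * w * ((2 ^ (ℓ + k)) ^ 2 - (2 ^ ℓ) ^ 2) - 9 / 2 * w ^ 2 * (2 ^ (ℓ + k) - 2 ^ ℓ)) with hγ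
    set y := Yy S z H with hy
    set s : ℝ := 2 ^ (ℓ + k) with hsdef
    have e1 : c * Kit Ψ (k + 1) H = avNZ fun v : NZ (ℓ + k + 1) =>
        0 + c * Kit Ψ k ((quo (ℓ + k) v).comp H) := by
      rw [avNZ_affine, zero_add]; rfl
    rw [e1]
    set b := s * (3 * y ^ 2 + 6 * s * y + 6 * s ^ 2) with hb
    have hb0 : 0 ≤ b := by positivity
    have e2 : (avNZ fun v : NZ (ℓ + k + 1) => 0 + c * Kit Ψ k ((quo (ℓ + k) v).comp H)) ≤
        avNZ fun v : NZ (ℓ + k + 1) => (y ^ 3 + 3 * s * y ^ 2 + 6 * s ^ 2 * y - γ - b) +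
          b * Real.exp ((Yy S z ((quo (ℓ + k) v).comp H) - y) / s) := by
      refine avNZ_mono fun v => ?_
      have h1 := ih ((quo (ℓ + k) v).comp H)
      have h2 := p_tangent s y (Yy S z ((quo (ℓ + k) v).comp H)) hs hY
        (Yy_nonneg S z hz _)
      rw [← hb] at h2
      linarith
    refine e2.trans ?_
    rw [avNZ_affine]
    have e3 := mul_le_mul_of_nonneg_left hexp hb0
    have e4 : 18 * s ^ 2 * w - 9 / 2 * w ^ 2 * s ≤ 18 * s ^ 2 * y := by
      have := mul_le_mul_of_nonneg_left hYge (show 0 ≤ 18 * s ^ 2 by positivity)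
      refine le_trans (le_of_eq ?_) this
      field_simp
      ring
    have e5 : 0 ≤ 3 * s * y ^ 2 := by positivity
    rw [hγ]
    linarith

theorem tail {U ℓ : ℕ} (S : Finset (Fin U → ZMod 2)) (z : ℝ) (hz : 1 ≤ z) (τ w : ℝ)
    (hw : w = S.card * (z - 1)) (hlw : 2 ^ ℓ ≤ w) (hτ : 2 * w ≤ τ) (Ψ : Lin U ℓ → ℝ)
    (h1 : ∀ H, Ψ H ≤ 1) (h2 : ∀ H, Yy S z H < τ → Ψ H ≤ 0) :
    avL Ψ ≤ 48 * (w / τ) ^ 2 := by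
  have hl : (1:ℝ) ≤ 2 ^ ℓ := one_le_pow₀ (by norm_num)
  have hw0 : 0 < w := by linarith
  have hτ0 : 0 < τ := by linarith
  obtain ⟨n, hn1, hn2⟩ := exists_nat_pow_near (x := 2 * τ) (y := 2) (by linarith) (by norm_num)
  have hn3 : τ < 2 ^ n := by rw [pow_succ] at hn2; linarith
  have hln : ℓ ≤ n := by
    have : (2:ℝ) ^ ℓ < 2 ^ n := by linarith
    exact (pow_lt_pow_iff_right₀ (by norm_num : (1:ℝ) < 2)).1 this |>.le
  obtain ⟨k, rfl⟩ := Nat.exists_eq_add_of_le hln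
  have hK := Kit_le S z hz (τ ^ 3) w hw Ψ (by
    intro H
    have hY := Yy_nonneg S z hz H
    rcases lt_or_ge (Yy S z H) τ with hlt | hge
    · have : τ ^ 3 * Ψ H ≤ 0 := mul_nonpos_of_nonneg_of_nonpos (by positivity) (h2 H hlt)
      have : 0 ≤ Yy S z H ^ 3 + 3 * 2 ^ ℓ * Yy S z H ^ 2 + 6 * (2 ^ ℓ) ^ 2 * Yy S z H := by
        positivity
      linarith
    · have a1 : τ ^ 3 * Ψ H ≤ τ ^ 3 * 1 := mul_le_mul_of_nonneg_left (h1 H) (by positivity)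
      have a2 : τ ^ 3 ≤ Yy S z H ^ 3 := pow_le_pow_left₀ hτ0.le hge 3
      have : 0 ≤ 3 * 2 ^ ℓ * Yy S z H ^ 2 + 6 * (2 ^ ℓ) ^ 2 * Yy S z H := by
        positivity
      linarith) k
  set T : ℝ := 2 ^ (ℓ + k) with hT
  set L : ℝ := 2 ^ ℓ with hL
  have hT0 : 0 < T := by positivity
  have hpt : ∀ H : Lin U (ℓ + k), Kit Ψ k H ≤
      (29 * (w / τ) ^ 2 + 38 / τ * (w ^ 2 / (2 * T) - w)) + 38 / τ * Yy S z H := by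
    intro H
    have hY := Yy_nonneg S z hz H
    have hYge := Yy_ge S z hz H
    rw [← hw, ← hT] at hYge
    have hKH := hK H
    set y := Yy S z H
    set D := y - w + w ^ 2 / (2 * T) with hD
    have hD0 : 0 ≤ D := by linarith
    have hq : w ^ 2 / (2 * T) ≤ w := by
      rw [div_le_iff₀ (by positivity)]; nlinarith
    have hq0 : 0 ≤ w ^ 2 / (2 * T) := by positivity
    suffices hs : Kit Ψ k H ≤ 29 * (w / τ) ^ 2 + 38 / τ * D by
      rw [hD] at hs; linarith
    have h0 : 29 * (w / τ) ^ 2 + 38 / τ * D = (29 * w ^ 2 * τ + 38 * τ ^ 2 * D) / τ ^ 3 := by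
      field_simp
    rw [h0, le_div_iff₀ (by positivity)]
    rcases le_total y τ with hyt | hyt
    · have hDt : D ≤ τ := by linarith
      have hywD : y ≤ w + D := by linarith
      have b1 : y ^ 2 ≤ 2 * w ^ 2 + 2 * (τ * D) := by
        have : y ^ 2 ≤ (w + D) ^ 2 := pow_le_pow_left₀ hY hywD 2
        have c2 := mul_le_mul_of_nonneg_right hDt hD0
        nlinarith [sq_nonneg (w - D)]
      have b0 : 0 ≤ 2 * w ^ 2 + 2 * (τ * D) := by positivity
      have b2 : y ^ 3 ≤ τ * (2 * w ^ 2 + 2 * (τ * D)) := by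
        calc y ^ 3 = y * y ^ 2 := by ring
          _ ≤ τ * (2 * w ^ 2 + 2 * (τ * D)) := mul_le_mul hyt b1 (by positivity) hτ0.le
      have b3 : 3 * T * y ^ 2 ≤ 3 * (2 * τ) * (2 * w ^ 2 + 2 * (τ * D)) := by
        refine mul_le_mul (by linarith) b1 (by positivity) (by positivity)
      have b4 : 6 * T ^ 2 * (y - w) ≤ 24 * τ ^ 2 * D := by
        have c1 : 6 * T ^ 2 * (y - w) ≤ 6 * T ^ 2 * D :=
          mul_le_mul_of_nonneg_left (by linarith) (by positivity)
        have c2 : T ^ 2 ≤ (2 * τ) ^ 2 := pow_le_pow_left₀ hT0.le hn1 2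
        have c3 := mul_le_mul_of_nonneg_right c2 hD0
        linarith
      have b5 : 6 * w * L ^ 2 ≤ 6 * w ^ 2 * τ := by
        have : L ^ 2 ≤ w ^ 2 := pow_le_pow_left₀ (by positivity) hlw 2
        have c : w * L ^ 2 ≤ τ * w ^ 2 := mul_le_mul (by linarith) this (by positivity) hτ0.le
        linarith
      have b6 : 9 / 2 * w ^ 2 * (T - L) ≤ 9 * w ^ 2 * τ := by
        have : w ^ 2 * (T - L) ≤ w ^ 2 * (2 * τ) :=
          mul_le_mul_of_nonneg_left (by linarith) (by positivity)
        linarith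
      linarith
    · have c1 := Kit_le_one Ψ h1 k H
      have c2 : τ / 2 ≤ D := by linarith
      have c3 : Kit Ψ k H * τ ^ 3 ≤ 1 * τ ^ 3 := mul_le_mul_of_nonneg_right c1 (by positivity)
      have c4 : 38 * τ ^ 2 * (τ / 2) ≤ 38 * τ ^ 2 * D :=
        mul_le_mul_of_nonneg_left c2 (by positivity)
      have c5 : 0 ≤ 29 * w ^ 2 * τ := by positivity
      have c6 : 0 ≤ τ ^ 3 := by positivity
      linarith
  rw [← avL_Kit Ψ k]
  refine (avL_mono hpt).trans ?_
  rw [avL_affine]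
  have hav := avY_le (m := ℓ + k) S z hz
  rw [← hw] at hav
  have d1 := mul_le_mul_of_nonneg_left hav (show 0 ≤ 38 / τ by positivity)
  have d2 : 38 / τ * (w ^ 2 / (2 * T)) ≤ 19 * (w / τ) ^ 2 := by
    rw [show 19 * (w / τ) ^ 2 = 38 / τ * (w ^ 2 / (2 * τ)) by field_simp; norm_num]
    refine mul_le_mul_of_nonneg_left ?_ (by positivity)
    exact div_le_div_of_nonneg_left (by positivity) (by positivity) (by linarith)
  linarith

theorem prod_ge (n : ℕ) :
    (1 / 4 : ℝ) + 1 / 2 ^ (n + 2) ≤ ∏ j ∈ Finset.range (n + 1), (1 - 1 / 2 ^ (j + 1)) := by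
  induction n with
  | zero => norm_num
  | succ n ih =>
    rw [Finset.prod_range_succ]
    have ha : (1:ℝ) / 2 ^ (n + 2) ≤ 1 / 4 := by
      refine one_div_le_one_div_of_le (by norm_num) ?_
      have : (1:ℝ) ≤ 2 ^ n := one_le_pow₀ (by norm_num)
      rw [pow_add]; linarith
    have ha0 : (0:ℝ) < 1 / 2 ^ (n + 2) := by positivity
    have h1 : (1:ℝ) / 2 ^ (n + 1 + 2) = (1 / 2 ^ (n + 2)) / 2 := by
      rw [show n + 1 + 2 = (n + 2) + 1 by ring, pow_succ]; field_simp
    rw [h1, show n + 1 + 1 = n + 2 by ring]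
    have := mul_le_mul_of_nonneg_right ih (show (0:ℝ) ≤ 1 - 1 / 2 ^ (n + 2) by linarith)
    nlinarith

theorem surj_iff {U ℓ : ℕ} (H : Lin U ℓ) :
    Function.Surjective H ↔ LinearIndependent (ZMod 2) (LinearMap.toMatrix' H).row := by
  constructor
  · intro h
    rw [← Matrix.vecMul_injective_iff]
    obtain ⟨B, hB⟩ := Matrix.mulVec_surjective_iff_exists_right_inverse.1
      (show Function.Surjective (LinearMap.toMatrix' H).mulVec by
        intro y
        obtain ⟨x, hx⟩ := h y
        exact ⟨x, by rw [LinearMap.toMatrix'_mulVec, hx]⟩)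
    intro a b hab
    have := congrArg (fun v => Matrix.vecMul v B) hab
    simpa [Matrix.vecMul_vecMul, hB] using this
  · intro h
    have h1 := h.rank_matrix
    rw [← LinearMap.range_eq_top]
    apply Submodule.eq_top_of_finrank_eq
    rw [Matrix.rank] at h1
    have e : (LinearMap.toMatrix' H).mulVecLin = H := by
      rw [← Matrix.toLin'_apply', Matrix.toLin'_toMatrix']
    rw [e] at h1
    rw [h1]; simp

theorem card_surj (U ℓ : ℕ) (hl : ℓ ≤ U) :
    (Fintype.card (Lin U ℓ) : ℝ) / 4 ≤ Nat.card {H : Lin U ℓ // Function.Surjective H} := by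
  have h1 : Nat.card {H : Lin U ℓ // Function.Surjective H} =
      ∏ i : Fin ℓ, (2 ^ U - 2 ^ (i : ℕ)) := by
    have := card_linearIndependent (K := ZMod 2) (V := Fin U → ZMod 2) (k := ℓ) (by simpa using hl)
    rw [ZMod.card] at this
    simp only [Module.finrank_fin_fun] at this
    rw [← this]
    exact Nat.card_congr ((LinearMap.toMatrix' (R := ZMod 2)).toEquiv.subtypeEquiv fun H => surj_iff H)
  have h2 : Fintype.card (Lin U ℓ) = (2 ^ U) ^ ℓ := by
    have e := Fintype.card_congr (show Lin U ℓ ≃ (Fin ℓ → Fin U → ZMod 2) from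
      (LinearMap.toMatrix' (R := ZMod 2) (m := Fin ℓ) (n := Fin U)).toEquiv)
    rw [e]
    simp [ZMod.card]
  rw [h1, h2]
  push_cast
  have h3 : ∏ i : Fin ℓ, ((2:ℝ) ^ U * (1 - 1 / 2 ^ (i.rev.val + 1))) ≤
      ∏ i : Fin ℓ, (((2 ^ U - 2 ^ (i : ℕ) : ℕ)) : ℝ) := by
    refine Finset.prod_le_prod ?_ ?_
    · intro i _
      have : (1:ℝ) / 2 ^ (i.rev.val + 1) ≤ 1 := by
        rw [div_le_one (by positivity)]
        exact one_le_pow₀ (by norm_num)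
      exact mul_nonneg (by positivity) (by linarith)
    · intro i _
      have hi := i.2
      rw [Nat.cast_sub (Nat.pow_le_pow_right (by norm_num) (by omega))]
      push_cast
      rw [mul_sub, mul_one, mul_one_div]
      refine sub_le_sub_left ?_ _
      rw [le_div_iff₀ (by positivity), ← pow_add]
      refine pow_le_pow_right₀ (by norm_num) ?_
      rw [Fin.val_rev]
      omega
  refine le_trans ?_ h3
  rw [Finset.prod_mul_distrib, Finset.prod_const, Finset.card_univ, Fintype.card_fin,
    div_eq_mul_one_div]
  refine mul_le_mul_of_nonneg_left ?_ (by positivity)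
  have h4 : ∏ i : Fin ℓ, (1 - 1 / (2:ℝ) ^ (i.rev.val + 1)) =
      ∏ j ∈ Finset.range ℓ, (1 - 1 / (2:ℝ) ^ (j + 1)) := by
    rw [← Fin.prod_univ_eq_prod_range (fun j => (1 - 1 / (2:ℝ) ^ (j + 1))) ℓ]
    exact Equiv.prod_comp Fin.revPerm (fun i : Fin ℓ => (1 - 1 / (2:ℝ) ^ (i.val + 1)))
  rw [h4]
  cases ℓ with
  | zero => norm_num
  | succ n =>
    refine le_trans ?_ (prod_ge n)
    have : (0:ℝ) < 1 / 2 ^ (n + 2) := by positivity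
    linarith

theorem Yy_of_load {U ℓ : ℕ} (S : Finset (Fin U → ZMod 2)) (z r : ℝ) (hz : 1 ≤ z)
    (H : Lin U ℓ) (hr0 : 0 < r) (hzr : Real.log z = 1 + ℓ * Real.log 2 / r)
    (hr : r ≤ (maxLoad U ℓ S H : ℝ)) : 2 ^ ℓ * r ≤ Yy S z H := by
  obtain ⟨y, -, hy⟩ := Finset.exists_mem_eq_sup (Finset.univ : Finset (Fin ℓ → ZMod 2))
    Finset.univ_nonempty (fun y => load S H y)
  have hy' : maxLoad U ℓ S H = load S H y := hy
  rw [hy'] at hr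
  have h1 : z ^ load S H y ≤ ∑ y, z ^ load S H y :=
    Finset.single_le_sum (f := fun y => z ^ load S H y) (fun _ _ => by positivity)
      (Finset.mem_univ y)
  have h2 : z ^ load S H y / 2 ^ ℓ ≤ Aa S z H := div_le_div_of_nonneg_right h1 (by positivity)
  have hz0 : 0 < z := by linarith
  have h3 := Real.log_le_log (by positivity) h2
  rw [Real.log_div (by positivity) (by positivity), Real.log_pow, Real.log_pow] at h3
  unfold Yy
  refine mul_le_mul_of_nonneg_left (le_trans ?_ h3) (by positivity)
  have h4 : r * Real.log z ≤ load S H y * Real.log z :=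
    mul_le_mul_of_nonneg_right hr (Real.log_nonneg hz)
  have h5 : r * Real.log z = r + ℓ * Real.log 2 := by
    rw [hzr]; field_simp
  linarith

theorem main_bound {U ℓ : ℕ} (hl : ℓ ≤ U) (S : Finset (Fin U → ZMod 2)) (hS : S.card = 2 ^ ℓ)
    (r X : ℝ) (hr0 : 0 < r) (hX : X = Real.exp (ℓ * Real.log 2 / r))
    (hrX : 2 * Real.exp 1 * X ≤ r) :
    (Nat.card {H : {H : Lin U ℓ // Function.Surjective H} // r ≤ (maxLoad U ℓ S H.1 : ℝ)} : ℝ) /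
      (Nat.card {H : Lin U ℓ // Function.Surjective H} : ℝ) ≤
      192 * (Real.exp 1 * X / r) ^ 2 := by
  classical
  set z : ℝ := Real.exp 1 * X with hz
  have hX1 : 1 ≤ X := by
    rw [hX]; exact Real.one_le_exp (by positivity)
  have he : 2 < Real.exp 1 := by linarith [Real.exp_one_gt_d9]
  have hz2 : 2 ≤ z := by nlinarith
  have hlog : Real.log z = 1 + ℓ * Real.log 2 / r := by
    rw [hz, hX, ← Real.exp_add, Real.log_exp]
  set Ψ : Lin U ℓ → ℝ := fun H => if r ≤ (maxLoad U ℓ S H : ℝ) then 1 else 0 with hΨ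
  have hp : (0:ℝ) < 2 ^ ℓ := by positivity
  have ht := tail S z (by linarith) (2 ^ ℓ * r) (S.card * (z - 1)) rfl
    (by rw [hS]; push_cast; nlinarith) (by rw [hS]; push_cast; nlinarith) Ψ
    (by intro H; simp only [hΨ]; split_ifs <;> norm_num)
    (by
      intro H hH
      simp only [hΨ]
      rw [if_neg]
      intro hr
      exact absurd (Yy_of_load S z r (by linarith) H hr0 hlog hr) (not_le.2 hH))
  have hsq : (S.card * (z - 1) / (2 ^ ℓ * r)) ^ 2 ≤ (z / r) ^ 2 := by
    rw [hS]; push_cast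
    rw [mul_div_mul_left _ _ hp.ne']
    refine pow_le_pow_left₀ (div_nonneg (by linarith) hr0.le) ?_ 2
    exact div_le_div_of_nonneg_right (by linarith) hr0.le
  have hc0 : (0:ℝ) < Fintype.card (Lin U ℓ) := by exact_mod_cast Fintype.card_pos
  have hcs := card_surj U ℓ hl
  have hbad : (Nat.card {H : {H : Lin U ℓ // Function.Surjective H} //
      r ≤ (maxLoad U ℓ S H.1 : ℝ)} : ℝ) ≤ ∑ H, Ψ H := by
    have e : ∑ H, Ψ H = (Nat.card {H : Lin U ℓ // r ≤ (maxLoad U ℓ S H : ℝ)} : ℝ) := by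
      rw [Nat.card_eq_fintype_card, Fintype.card_subtype]
      simp [hΨ]
    rw [e]
    exact_mod_cast Nat.card_le_card_of_injective
      (fun H : {H : {H : Lin U ℓ // Function.Surjective H} // r ≤ (maxLoad U ℓ S H.1 : ℝ)} =>
        (⟨H.1.1, H.2⟩ : {H : Lin U ℓ // r ≤ (maxLoad U ℓ S H : ℝ)}))
      (fun a b hab => by
        apply Subtype.ext; apply Subtype.ext
        exact (Subtype.mk.injEq _ _ _ _).mp hab)
  have h48 : ∑ H, Ψ H ≤ 48 * (z / r) ^ 2 * Fintype.card (Lin U ℓ) := by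
    have : avL Ψ ≤ 48 * (z / r) ^ 2 := by linarith
    rwa [avL, div_le_iff₀ hc0] at this
  rw [div_le_iff₀ (by linarith)]
  have h5 := mul_le_mul_of_nonneg_left hcs (show 0 ≤ 192 * (z / r) ^ 2 by positivity)
  linarith

theorem stmt_10 :
    ∃ C₀ > (0 : ℝ), ∃ D₀ > (0 : ℝ), ∃ ℓ₀ : ℕ,
      ∀ (ℓ U : ℕ), ℓ₀ ≤ ℓ → ℓ ≤ U →
      ∀ S : Finset (Fin U → ZMod 2), S.card = 2 ^ ℓ →
      ∀ R : ℝ, 1 < R → D₀ * Real.log ℓ ≤ R * (ℓ : ℝ) ^ (1 - 1 / R) →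
      (Nat.card {H : {H : Lin U ℓ // Function.Surjective H} //
            R * ℓ / Real.logb 2 ℓ ≤ (maxLoad U ℓ S H.1 : ℝ)} : ℝ) /
          (Nat.card {H : Lin U ℓ // Function.Surjective H} : ℝ) ≤
        C₀ * (Real.log ℓ) ^ 2 / (R ^ 2 * (ℓ : ℝ) ^ (2 - 2 / R)) := by
  have hl2 : 0 < Real.log 2 := Real.log_pos (by norm_num)
  refine ⟨192 * (Real.exp 1 / Real.log 2) ^ 2, by positivity, 2 * Real.exp 1 / Real.log 2,
    by positivity, 2, ?_⟩
  intro ℓ U hℓ hU S hS R hR hD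
  have hℓ1 : (1:ℝ) < ℓ := by exact_mod_cast (by omega : 1 < ℓ)
  have hℓ0 : (0:ℝ) < ℓ := by linarith
  have hln : 0 < Real.log ℓ := Real.log_pos hℓ1
  have hR0 : 0 < R := by linarith
  have hr : R * ℓ / Real.logb 2 ℓ = R * ℓ * Real.log 2 / Real.log ℓ := by
    rw [Real.logb]; field_simp
  rw [hr]
  set P : ℝ := (ℓ : ℝ) ^ (1 - 1 / R) with hP
  have hP0 : 0 < P := by positivity
  set X : ℝ := (ℓ : ℝ) ^ (1 / R) with hX
  have hX0 : 0 < X := by positivity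
  have hPX : P * X = ℓ := by
    rw [hP, hX, ← Real.rpow_add hℓ0]; simp
  have hP2 : (ℓ : ℝ) ^ (2 - 2 / R) = P ^ 2 := by
    rw [hP, ← Real.rpow_natCast, ← Real.rpow_mul hℓ0.le]
    congr 1; push_cast; ring
  have hXe : X = Real.exp (ℓ * Real.log 2 / (R * ℓ * Real.log 2 / Real.log ℓ)) := by
    rw [hX, Real.rpow_def_of_pos hℓ0]
    congr 1
    field_simp
  have hXr : R * ℓ * Real.log 2 / Real.log ℓ = X * (R * P * Real.log 2 / Real.log ℓ) := by
    rw [← hPX]; ring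
  have hD' : 2 * Real.exp 1 ≤ R * P * Real.log 2 / Real.log ℓ := by
    rw [le_div_iff₀ hln]
    have := mul_le_mul_of_nonneg_right hD hl2.le
    refine le_trans (le_of_eq ?_) this
    field_simp
  have := main_bound hU S hS (R * ℓ * Real.log 2 / Real.log ℓ) X (by positivity) hXe (by
    rw [hXr, mul_comm]
    exact mul_le_mul_of_nonneg_left hD' hX0.le)
  refine this.trans (le_of_eq ?_)
  rw [hP2, hXr]
  field_simp
end

section
/- There exist absolute constants C_0 > 0 and D_0 > 0 such that the following holds. Let U ≥ ℓ, let S ⊆ F_2^U have size m, set n = 2^ℓ and λ = m/n, and let H : F_2^U → F_2^ℓ be chosen uniformly at random from the set of all surjective F_2-linear maps from F_2^U to F_2^ℓ. Then for every real T > 0 satisfying T ≥ D_0 λ n^{1/T}, one has Pr[M(S,H) ≥ T] ≤ C_0 (λ n^{1/T} / T)^2. -/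
theorem zmod_two_cases (r : ZMod 2) : r = 0 ∨ r = 1 := by
  revert r; decide

open Classical in
/-- Sum over the target of the products of `g` over the fibres. -/
noncomputable def fibSum {V W : Type} [AddCommGroup V] [Module (ZMod 2) V] [Fintype V]
    [AddCommGroup W] [Module (ZMod 2) W] [Fintype W] (g : V → ℝ) (H : V →ₗ[ZMod 2] W) : ℝ :=
  ∑ y : W, ∏ x ∈ Finset.univ.filter (fun x => H x = y), g x

/-- Number of surjections with property `P`. -/
noncomputable def cnt {V W : Type} [AddCommGroup V] [Module (ZMod 2) V]
    [AddCommGroup W] [Module (ZMod 2) W] (P : (V →ₗ[ZMod 2] W) → Prop) : ℕ :=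
  Nat.card {H : V →ₗ[ZMod 2] W // Function.Surjective H ∧ P H}

theorem cnt_mono {V W : Type} [AddCommGroup V] [Module (ZMod 2) V] [Finite V]
    [AddCommGroup W] [Module (ZMod 2) W] [Finite W] (P Q : (V →ₗ[ZMod 2] W) → Prop)
    (h : ∀ H : V →ₗ[ZMod 2] W, Function.Surjective H → P H → Q H) : cnt P ≤ cnt Q := by
  unfold cnt
  have : Finite (V →ₗ[ZMod 2] W) := DFunLike.finite _
  exact Nat.card_le_card_of_injective
    (fun H => (⟨H.1, H.2.1, h _ H.2.1 H.2.2⟩ : {H : V →ₗ[ZMod 2] W // Function.Surjective H ∧ Q H}))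
    (fun a b hab => by
      have := congrArg (fun z => z.1) hab
      exact Subtype.ext this)

theorem card_ker_ne {V W : Type} [AddCommGroup V] [Module (ZMod 2) V] [Finite V]
    [AddCommGroup W] [Module (ZMod 2) W] [Finite W] (l K : ℕ)
    (hW : Module.finrank (ZMod 2) W = l) (hV : Module.finrank (ZMod 2) V = l + K)
    (H : V →ₗ[ZMod 2] W) (hH : Function.Surjective H) :
    Nat.card (LinearMap.ker H) = 2 ^ K := by
  have h1 := LinearMap.finrank_range_add_finrank_ker H
  rw [LinearMap.range_eq_top.2 hH, finrank_top, hW, hV] at h1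
  have h2 : Module.finrank (ZMod 2) (LinearMap.ker H) = K := by omega
  rw [Module.natCard_eq_pow_finrank (K := ZMod 2), h2]
  simp

open Classical in
theorem double_count {V W : Type} [AddCommGroup V] [Module (ZMod 2) V] [Fintype V]
    [AddCommGroup W] [Module (ZMod 2) W] [Fintype W] (l K : ℕ)
    (hW : Module.finrank (ZMod 2) W = l) (hV : Module.finrank (ZMod 2) V = l + K)
    (P : (V →ₗ[ZMod 2] W) → Prop) :
    cnt P * (2 ^ K - 1) = ∑ v ∈ Finset.univ.filter (fun v : V => v ≠ 0),
      cnt (fun H : V →ₗ[ZMod 2] W => H v = 0 ∧ P H) := by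
  have : Finite (V →ₗ[ZMod 2] W) := DFunLike.finite _
  have : Fintype (V →ₗ[ZMod 2] W) := Fintype.ofFinite _
  have e : ∀ Q : (V →ₗ[ZMod 2] W) → Prop,
      cnt Q = (Finset.univ.filter (fun H : V →ₗ[ZMod 2] W => Function.Surjective H ∧ Q H)).card := by
    intro Q
    unfold cnt
    rw [Nat.card_eq_fintype_card, Fintype.card_subtype]
  have h := Finset.sum_card_bipartiteAbove_eq_sum_card_bipartiteBelow
    (s := Finset.univ.filter (fun H : V →ₗ[ZMod 2] W => Function.Surjective H ∧ P H))
    (t := Finset.univ.filter (fun v : V => v ≠ 0)) (fun H v => H v = 0)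
  have h1 : ∀ H ∈ Finset.univ.filter (fun H : V →ₗ[ZMod 2] W => Function.Surjective H ∧ P H),
      (Finset.bipartiteAbove (fun (H : V →ₗ[ZMod 2] W) v => H v = 0)
        (Finset.univ.filter (fun v : V => v ≠ 0)) H).card = 2 ^ K - 1 := by
    intro H hH
    have hk := card_ker_ne l K hW hV H (Finset.mem_filter.1 hH).2.1
    have : Finset.bipartiteAbove (fun (H : V →ₗ[ZMod 2] W) v => H v = 0)
        (Finset.univ.filter (fun v : V => v ≠ 0)) H
        = (Finset.univ.filter (fun v : V => H v = 0)).erase 0 := by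
      ext v
      simp [Finset.mem_bipartiteAbove]
    rw [this, Finset.card_erase_of_mem (by simp), ← hk, Nat.card_eq_fintype_card]
    congr 1
    rw [← Fintype.card_subtype]
    apply Fintype.card_congr
    exact Equiv.refl _
  rw [Finset.sum_congr rfl h1, Finset.sum_const, smul_eq_mul, ← e] at h
  rw [h]
  apply Finset.sum_congr rfl
  intro v _
  rw [e]
  congr 1
  ext H
  simp [Finset.mem_bipartiteBelow]
  tauto

theorem cnt_quot {V W : Type} [AddCommGroup V] [Module (ZMod 2) V]
    [AddCommGroup W] [Module (ZMod 2) W] (v : V) (P : (V →ₗ[ZMod 2] W) → Prop) :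
    cnt (fun H : V →ₗ[ZMod 2] W => H v = 0 ∧ P H) =
    cnt (fun H : (V ⧸ Submodule.span (ZMod 2) {v}) →ₗ[ZMod 2] W =>
      P (H.comp (Submodule.mkQ _))) := by
  unfold cnt
  symm
  apply Nat.card_eq_of_bijective (fun H =>
    (⟨H.1.comp (Submodule.mkQ _), by
        simpa using H.2.1.comp (Submodule.mkQ_surjective _), by
        have : (Submodule.mkQ (Submodule.span (ZMod 2) {v})) v = 0 := by
          simp [Submodule.mem_span_singleton_self]
        rw [LinearMap.comp_apply, this, map_zero], H.2.2⟩ :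
      {H : V →ₗ[ZMod 2] W // Function.Surjective H ∧ H v = 0 ∧ P H}))
  constructor
  · intro a b hab
    have := congrArg (fun z => z.1) hab
    apply Subtype.ext
    exact Submodule.linearMap_qext _ this
  · rintro ⟨H, h1, h2, h3⟩
    have hle : Submodule.span (ZMod 2) {v} ≤ LinearMap.ker H := by
      rw [Submodule.span_le]
      simpa using h2
    have hc : (Submodule.liftQ _ H hle).comp (Submodule.mkQ _) = H := Submodule.liftQ_mkQ _ _ _
    refine ⟨⟨Submodule.liftQ _ H hle, ?_, ?_⟩, ?_⟩
    · intro y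
      obtain ⟨x, rfl⟩ := h1 y
      exact ⟨Submodule.mkQ _ x, by simp⟩
    · show P _
      rw [hc]; exact h3
    · exact Subtype.ext hc

theorem cnt_congr_finrank {V V' W : Type} [AddCommGroup V] [Module (ZMod 2) V] [Finite V]
    [AddCommGroup V'] [Module (ZMod 2) V'] [Finite V']
    [AddCommGroup W] [Module (ZMod 2) W]
    (h : Module.finrank (ZMod 2) V = Module.finrank (ZMod 2) V') :
    cnt (fun _ : V →ₗ[ZMod 2] W => True) = cnt (fun _ : V' →ₗ[ZMod 2] W => True) := by
  let e : V ≃ₗ[ZMod 2] V' := LinearEquiv.ofFinrankEq _ _ h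
  unfold cnt
  apply Nat.card_congr
  refine Equiv.subtypeEquiv (LinearEquiv.congrLeft W (ZMod 2) e).toEquiv ?_
  intro H
  have : ⇑((LinearEquiv.congrLeft W (ZMod 2) e).toEquiv H) = H ∘ e.symm := by
    ext x; rfl
  rw [this]
  simp [e.symm.surjective.of_comp_iff]

theorem finrank_quot {V : Type} [AddCommGroup V] [Module (ZMod 2) V] [Finite V] (d : ℕ)
    (hV : Module.finrank (ZMod 2) V = d + 1) (v : V) (hv : v ≠ 0) :
    Module.finrank (ZMod 2) (V ⧸ Submodule.span (ZMod 2) {v}) = d := by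
  have h1 := Submodule.finrank_quotient_add_finrank (Submodule.span (ZMod 2) {v})
  rw [finrank_span_singleton hv] at h1
  omega

open Classical in
/-- Fibre products on the quotient. -/
noncomputable def qprod {V : Type} [AddCommGroup V] [Module (ZMod 2) V] [Fintype V] (v : V)
    (g : V → ℝ) (c : V ⧸ Submodule.span (ZMod 2) {v}) : ℝ :=
  ∏ x ∈ Finset.univ.filter (fun x => Submodule.mkQ (Submodule.span (ZMod 2) {v}) x = c), g x

theorem fibSum_quot {V W : Type} [AddCommGroup V] [Module (ZMod 2) V] [Fintype V]
    [AddCommGroup W] [Module (ZMod 2) W] [Fintype W] (v : V)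
    [Fintype (V ⧸ Submodule.span (ZMod 2) {v})] (g : V → ℝ)
    (H : (V ⧸ Submodule.span (ZMod 2) {v}) →ₗ[ZMod 2] W) :
    fibSum g (H.comp (Submodule.mkQ _)) = fibSum (qprod v g) H := by
  classical
  unfold fibSum qprod
  apply Finset.sum_congr rfl
  intro y _
  rw [← Finset.prod_fiberwise_of_maps_to
    (s := Finset.univ.filter (fun x => (H.comp (Submodule.mkQ _)) x = y))
    (t := Finset.univ.filter (fun c => H c = y))
    (g := fun x => Submodule.mkQ (Submodule.span (ZMod 2) {v}) x)]
  · apply Finset.prod_congr rfl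
    intro c hc
    apply Finset.prod_congr _ (fun _ _ => rfl)
    ext x
    simp only [Finset.mem_filter, Finset.mem_univ, true_and, LinearMap.comp_apply] at hc ⊢
    constructor
    · exact fun h => h.2
    · intro h
      exact ⟨by rw [h, hc], h⟩
  · intro x hx
    exact Finset.mem_filter.2 ⟨Finset.mem_univ _, (Finset.mem_filter.1 hx).2⟩

theorem sum_qprod {V : Type} [AddCommGroup V] [Module (ZMod 2) V] [Fintype V] (v : V)
    [Fintype (V ⧸ Submodule.span (ZMod 2) {v})] (hv : v ≠ 0) (g : V → ℝ) :
    2 * ∑ c, qprod v g c = ∑ x, g x * g (x + v) := by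
  classical
  rw [← Finset.sum_fiberwise (s := Finset.univ)
    (g := fun x => Submodule.mkQ (Submodule.span (ZMod 2) {v}) x), Finset.mul_sum]
  apply Finset.sum_congr rfl
  intro c _
  obtain ⟨x, rfl⟩ := Submodule.mkQ_surjective _ c
  have hvv : v + v = 0 := by
    have : (2 : ZMod 2) • v = 0 := by
      have h2 : (2 : ZMod 2) = 0 := by decide
      rw [h2, zero_smul]
    rwa [two_smul] at this
  have hne : x ≠ x + v := by simpa using hv
  have hf : Finset.univ.filter (fun z => Submodule.mkQ (Submodule.span (ZMod 2) {v}) z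
      = Submodule.mkQ (Submodule.span (ZMod 2) {v}) x) = {x, x + v} := by
    ext z
    rw [Finset.mem_filter, Finset.mem_insert, Finset.mem_singleton]
    simp only [Finset.mem_univ, true_and, Submodule.mkQ_apply]
    rw [Submodule.Quotient.eq, Submodule.mem_span_singleton]
    constructor
    · rintro ⟨r, hr⟩
      have : r = 0 ∨ r = 1 := zmod_two_cases r
      rcases this with rfl | rfl
      · left
        rw [zero_smul] at hr
        exact (sub_eq_zero.1 hr.symm)
      · right
        rw [one_smul] at hr
        rw [hr]; abel
    · rintro (rfl | rfl)
      · exact ⟨0, by simp⟩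
      · exact ⟨1, by simp⟩
  unfold qprod
  rw [hf, Finset.prod_pair hne, Finset.sum_pair hne, add_assoc, hvv, add_zero]
  ring

theorem point_bound (b al r : ℝ) (hb : 0 < b) (hal : 0 ≤ al) (hr : 2 * al ≤ r) :
    min 1 (4 * (r / b) ^ 2) ≤ 16 * (al / b) ^ 2 + 4 / b * (r - 2 * al) := by
  obtain ⟨r, rfl⟩ : ∃ r', r = r' * b := ⟨r / b, by field_simp⟩
  obtain ⟨al, rfl⟩ : ∃ r', al = r' * b := ⟨al / b, by field_simp⟩
  have h1 : 4 / b * (r * b - 2 * (al * b)) = 4 * (r - 2 * al) := by field_simp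
  rw [h1, mul_div_cancel_right₀ _ hb.ne', mul_div_cancel_right₀ _ hb.ne']
  have hal' : 0 ≤ al := by
    by_contra hc
    push Not at hc
    nlinarith
  have hr' : 2 * al ≤ r := by
    by_contra hc
    push Not at hc
    nlinarith
  rcases le_total r (1 / 2) with h | h
  · refine (min_le_right _ _).trans ?_
    nlinarith
  · refine (min_le_left _ _).trans ?_
    nlinarith [sq_nonneg (4 * al - 1)]

theorem sum_shift {V : Type} [AddCommGroup V] [Fintype V] [DecidableEq V] (h : V → ℝ) (N al : ℝ)
    (hN : N = Fintype.card V) (hN0 : 0 < N) (hal : ∑ x, h x = N * al) :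
    ∑ v ∈ Finset.univ.filter (fun v : V => v ≠ 0), (∑ x, h x * h (x + v)) / N
      ≤ (N - 1) * al ^ 2 := by
  have e0 : Finset.univ.filter (fun v : V => v ≠ 0) = Finset.univ.erase 0 := by
    ext; simp
  have h1 : ∑ v, (∑ x, h x * h (x + v)) = (N * al) ^ 2 := by
    rw [Finset.sum_comm]
    have : ∀ x, ∑ v, h x * h (x + v) = h x * (N * al) := by
      intro x
      rw [← Finset.mul_sum, ← hal]
      congr 1
      exact Equiv.sum_comp (Equiv.addLeft x) h
    rw [Finset.sum_congr rfl (fun x _ => this x), ← Finset.sum_mul, hal]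
    ring
  have h2 := Finset.add_sum_erase Finset.univ (fun v => ∑ x, h x * h (x + v)) (Finset.mem_univ 0)
  have h3 := sq_sum_le_card_mul_sum_sq (s := Finset.univ) (f := h)
  rw [hal, Finset.card_univ, ← hN] at h3
  rw [e0, ← Finset.sum_div, div_le_iff₀ hN0]
  simp only [add_zero] at h2
  rw [h1] at h2
  have h4 : ∑ x, h x * h x = ∑ x, h x ^ 2 := by
    apply Finset.sum_congr rfl; intros; ring
  rw [h4] at h2
  have h5 : N * al ^ 2 ≤ ∑ x, h x ^ 2 := by
    have : N * (N * al ^ 2) ≤ N * ∑ x, h x ^ 2 := by linarith [h3, (by ring : (N*al)^2 = N * (N*al^2))]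
    exact le_of_mul_le_mul_left this hN0
  nlinarith

theorem main_bound_s16 {W : Type} [AddCommGroup W] [Module (ZMod 2) W] [Fintype W] (l : ℕ)
    (hW : Module.finrank (ZMod 2) W = l) : ∀ (K : ℕ) (V : Type) [AddCommGroup V]
    [Module (ZMod 2) V] [Fintype V], Module.finrank (ZMod 2) V = l + K →
    ∀ g : V → ℝ, (∀ x, 1 ≤ g x) → ∀ a : ℝ, 0 < a →
    (cnt (fun H : V →ₗ[ZMod 2] W => (1 + a) ^ (2 ^ K) * 2 ^ l ≤ fibSum g H) : ℝ) ≤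
      4 * (((∑ x, g x) / 2 ^ (l + K) - 1) / a) ^ 2 * cnt (fun _ : V →ₗ[ZMod 2] W => True) := by
  classical
  intro K
  induction K with
  | zero =>
    intro V _ _ _ hV g hg a ha
    by_cases hex : ∃ H : V →ₗ[ZMod 2] W, Function.Surjective H ∧
        (1 + a) ^ (2 ^ 0) * 2 ^ l ≤ fibSum g H
    · obtain ⟨H, hs, hH⟩ := hex
      have hi : Function.Injective H :=
        (LinearMap.injective_iff_surjective_of_finrank_eq_finrank (by rw [hV, hW]; rfl)).2 hs
      have hf : fibSum g H = ∑ x, g x := by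
        unfold fibSum
        rw [← (Equiv.ofBijective H ⟨hi, hs⟩).sum_comp]
        apply Finset.sum_congr rfl
        intro x _
        have : Finset.univ.filter (fun z => H z = (Equiv.ofBijective H ⟨hi, hs⟩) x) = {x} := by
          ext z
          rw [Finset.mem_filter, Finset.mem_singleton]
          exact ⟨fun h => hi h.2, fun h => ⟨Finset.mem_univ _, h ▸ rfl⟩⟩
        rw [this, Finset.prod_singleton]
      rw [hf] at hH
      have h1 : a ≤ (∑ x, g x) / 2 ^ (l + 0) - 1 := by
        rw [le_sub_iff_add_le, le_div_iff₀ (by positivity)]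
        simpa [add_comm] using hH
      have h2 : 1 ≤ ((∑ x, g x) / 2 ^ (l + 0) - 1) / a := by
        rwa [le_div_iff₀ ha, one_mul]
      have h3 : (cnt (fun H : V →ₗ[ZMod 2] W => (1 + a) ^ (2 ^ 0) * 2 ^ l ≤ fibSum g H) : ℝ) ≤
          cnt (fun _ : V →ₗ[ZMod 2] W => True) := by
        exact_mod_cast cnt_mono _ _ (fun _ _ _ => trivial)
      refine h3.trans (le_mul_of_one_le_left (Nat.cast_nonneg _) ?_)
      nlinarith
    · have : cnt (fun H : V →ₗ[ZMod 2] W => (1 + a) ^ (2 ^ 0) * 2 ^ l ≤ fibSum g H) = 0 := by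
        unfold cnt
        have : IsEmpty {H : V →ₗ[ZMod 2] W // Function.Surjective H ∧
            (1 + a) ^ (2 ^ 0) * 2 ^ l ≤ fibSum g H} := ⟨fun H => hex ⟨H.1, H.2⟩⟩
        exact Nat.card_of_isEmpty
      rw [this]
      simp only [Nat.cast_zero]
      positivity
  | succ K ih =>
    intro V _ _ _ hV g hg a ha
    have hcard : (Fintype.card V : ℝ) = 2 ^ (l + (K + 1)) := by
      have := Module.card_eq_pow_finrank (K := ZMod 2) (V := V)
      rw [this, hV, ZMod.card]; simp
    set N : ℝ := 2 ^ (l + (K + 1)) with hN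
    have hN0 : 0 < N := by positivity
    set al : ℝ := (∑ x, g x) / N - 1 with hal
    set b : ℝ := 2 * a + a ^ 2 with hb
    have hb0 : 0 < b := by positivity
    have hpow : (1 + a) ^ (2 ^ (K + 1)) = (1 + b) ^ (2 ^ K) := by
      rw [pow_succ, mul_comm, pow_mul]
      congr 1
      rw [hb]; ring
    set h : V → ℝ := fun x => g x - 1 with hh
    have hh0 : ∀ x, 0 ≤ h x := fun x => by simp only [hh]; linarith [hg x]
    have hsum : ∑ x, h x = N * al := by
      simp only [hh, Finset.sum_sub_distrib, Finset.sum_const, Finset.card_univ, nsmul_eq_mul,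
        hcard, hal]
      field_simp
    have hal0 : 0 ≤ al := by
      have : 0 ≤ N * al := hsum ▸ Finset.sum_nonneg (fun x _ => hh0 x)
      exact nonneg_of_mul_nonneg_right this hN0
    have hKpos : (0 : ℝ) < 2 ^ (K + 1) - 1 := by
      have : (2 : ℝ) ≤ 2 ^ (K + 1) := by
        calc (2 : ℝ) = 2 ^ 1 := by norm_num
          _ ≤ 2 ^ (K + 1) := pow_le_pow_right₀ (by norm_num) (by omega)
      linarith
    have hcast : ((2 ^ (K + 1) - 1 : ℕ) : ℝ) = 2 ^ (K + 1) - 1 := by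
      rw [Nat.cast_sub Nat.one_le_two_pow]; simp
    have d1 := double_count l (K + 1) hW hV
      (fun H : V →ₗ[ZMod 2] W => (1 + a) ^ (2 ^ (K + 1)) * 2 ^ l ≤ fibSum g H)
    have d2 := double_count l (K + 1) hW hV (fun _ : V →ₗ[ZMod 2] W => True)
    have d1' := congrArg (Nat.cast (R := ℝ)) d1
    have d2' := congrArg (Nat.cast (R := ℝ)) d2
    rw [Nat.cast_mul, hcast, Nat.cast_sum] at d1' d2'
    obtain ⟨s, hs⟩ : ∃ s : ℕ, ∀ v : V, v ≠ 0 →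
        cnt (fun _ : (V ⧸ Submodule.span (ZMod 2) {v}) →ₗ[ZMod 2] W => True) = s := by
      by_cases hv0 : ∃ v : V, v ≠ 0
      · obtain ⟨v0, hv0⟩ := hv0
        refine ⟨_, fun v hv => cnt_congr_finrank (V' := V ⧸ Submodule.span (ZMod 2) {v0}) ?_⟩
        rw [finrank_quot (l + K) hV v hv, finrank_quot (l + K) hV v0 hv0]
      · exact ⟨0, fun v hv => absurd ⟨v, hv⟩ hv0⟩
    have hcn : ((Finset.univ.filter (fun v : V => v ≠ 0)).card : ℝ) = N - 1 := by
      have e0 : Finset.univ.filter (fun v : V => v ≠ 0) = Finset.univ.erase 0 := by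
        ext; simp
      rw [e0, Finset.card_erase_of_mem (Finset.mem_univ _), Finset.card_univ,
        Nat.cast_sub Fintype.card_pos, hcard]
      simp
    have e2 : ∑ v ∈ Finset.univ.filter (fun v : V => v ≠ 0),
        (cnt (fun H : V →ₗ[ZMod 2] W => H v = 0 ∧ True) : ℝ) = (N - 1) * s := by
      rw [← hcn, ← nsmul_eq_mul, ← Finset.sum_const]
      apply Finset.sum_congr rfl
      intro v hv
      rw [cnt_quot v (fun _ => True), hs v (Finset.mem_filter.1 hv).2]
    have e1 : ∀ v ∈ Finset.univ.filter (fun v : V => v ≠ 0),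
        (cnt (fun H : V →ₗ[ZMod 2] W => H v = 0 ∧
          (1 + a) ^ (2 ^ (K + 1)) * 2 ^ l ≤ fibSum g H) : ℝ) ≤
        (16 * (al / b) ^ 2 + 4 / b * ((∑ x, h x * h (x + v)) / N)) * s := by
      intro v hv
      have hv0 : v ≠ 0 := (Finset.mem_filter.1 hv).2
      letI : Fintype (V ⧸ Submodule.span (ZMod 2) {v}) := Fintype.ofFinite _
      rw [cnt_quot v (fun H => (1 + a) ^ (2 ^ (K + 1)) * 2 ^ l ≤ fibSum g H)]
      simp only [fibSum_quot]
      rw [hpow]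
      have i1 := ih (V ⧸ Submodule.span (ZMod 2) {v}) (finrank_quot (l + K) hV v hv0)
        (qprod v g) (fun c => by
          unfold qprod
          exact Finset.prod_induction g (fun z => 1 ≤ z) (fun _ _ h1 h2 => one_le_mul_of_one_le_of_one_le h1 h2) le_rfl (fun x _ => hg x)) b hb0
      have i2 : (cnt (fun H : (V ⧸ Submodule.span (ZMod 2) {v}) →ₗ[ZMod 2] W =>
          (1 + b) ^ (2 ^ K) * 2 ^ l ≤ fibSum (qprod v g) H) : ℝ) ≤
          cnt (fun _ : (V ⧸ Submodule.span (ZMod 2) {v}) →ₗ[ZMod 2] W => True) := by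
        exact_mod_cast cnt_mono _ _ (fun _ _ _ => trivial)
      rw [hs v hv0] at i1 i2
      have hav : (∑ c, qprod v g c) / 2 ^ (l + K) - 1 = 2 * al + (∑ x, h x * h (x + v)) / N := by
        have q := sum_qprod v hv0 g
        have hsh : ∑ x, h (x + v) = N * al := by
          rw [← hsum]
          exact Equiv.sum_comp (Equiv.addRight v) h
        have q2 : ∑ x, g x * g (x + v) = N + 2 * (N * al) + ∑ x, h x * h (x + v) := by
          have : ∀ x, g x * g (x + v) = 1 + h x + h (x + v) + h x * h (x + v) := by
            intro x; simp only [hh]; ring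
          rw [Finset.sum_congr rfl (fun x _ => this x)]
          simp only [Finset.sum_add_distrib]
          rw [hsum, hsh]
          simp only [Finset.sum_const, Finset.card_univ, nsmul_eq_mul, hcard]
          ring
        have hN2 : (2 : ℝ) ^ (l + K) = N / 2 := by
          rw [hN, ← add_assoc, pow_succ]; ring
        rw [hN2]
        rw [q2] at q
        field_simp
        linarith
      rw [hav] at i1
      have hR : 0 ≤ (∑ x, h x * h (x + v)) / N :=
        div_nonneg (Finset.sum_nonneg (fun x _ => mul_nonneg (hh0 _) (hh0 _))) hN0.le
      have pb := point_bound b al (2 * al + (∑ x, h x * h (x + v)) / N) hb0 hal0 (by linarith)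
      rw [add_sub_cancel_left] at pb
      refine le_trans ?_ (mul_le_mul_of_nonneg_right pb (Nat.cast_nonneg s))
      rcases min_choice 1 (4 * ((2 * al + (∑ x, h x * h (x + v)) / N) / b) ^ 2) with hm | hm
      · rw [hm, one_mul]; exact i2
      · rw [hm]; exact i1
    have e3 := Finset.sum_le_sum e1
    rw [← d1', ← Finset.sum_mul, Finset.sum_add_distrib, Finset.sum_const, nsmul_eq_mul, hcn,
      ← Finset.mul_sum] at e3
    rw [e2] at d2'
    have ss := sum_shift h N al hcard.symm hN0 hsum
    have hN1 : 0 ≤ N - 1 := by rw [← hcn]; positivity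
    have key : 16 * (al / b) ^ 2 + 4 / b * al ^ 2 ≤ 4 * (al / a) ^ 2 := by
      have hbf : b = a * (2 + a) := by rw [hb]; ring
      have : 4 * (al / a) ^ 2 - (16 * (al / b) ^ 2 + 4 / b * al ^ 2)
          = al ^ 2 * (8 * a) / (a ^ 2 * (2 + a) ^ 2) := by
        rw [hbf]; field_simp; ring
      have h0 : 0 ≤ al ^ 2 * (8 * a) / (a ^ 2 * (2 + a) ^ 2) := by positivity
      linarith
    have fin : (cnt (fun H : V →ₗ[ZMod 2] W =>
        (1 + a) ^ (2 ^ (K + 1)) * 2 ^ l ≤ fibSum g H) : ℝ) * (2 ^ (K + 1) - 1) ≤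
        (4 * (al / a) ^ 2 * cnt (fun _ : V →ₗ[ZMod 2] W => True)) * (2 ^ (K + 1) - 1) := by
      rw [mul_assoc (4 * (al / a) ^ 2), d2', ← mul_assoc]
      refine e3.trans (mul_le_mul_of_nonneg_right ?_ (Nat.cast_nonneg s))
      calc _ ≤ (N - 1) * (16 * (al / b) ^ 2) + 4 / b * ((N - 1) * al ^ 2) := by
            gcongr
        _ = (16 * (al / b) ^ 2 + 4 / b * al ^ 2) * (N - 1) := by ring
        _ ≤ _ := mul_le_mul_of_nonneg_right key hN1
    exact le_of_mul_le_mul_right fin hKpos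

/-- There exist absolute constants C_0 > 0 and D_0 > 0 such that the following
holds. Let U ≥ ℓ, let S ⊆ F_2^U have size m, set n = 2^ℓ and λ = m/n, and let H : F_2^U → F_2^ℓ
be chosen uniformly at random from the set of all surjective F_2-linear maps from F_2^U to F_2^ℓ.
Then for every real T > 0 satisfying T ≥ D_0 λ n^{1/T}, one has
Pr[M(S,H) ≥ T] ≤ C_0 (λ n^{1/T} / T)^2. -/
theorem stmt_16 :
    ∃ C₀ > (0 : ℝ), ∃ D₀ > (0 : ℝ),
      ∀ (ℓ U : ℕ), ℓ ≤ U →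
      ∀ (S : Finset (Fin U → ZMod 2)) (m n : ℕ), S.card = m → n = 2 ^ ℓ →
      ∀ lam : ℝ, lam = (m : ℝ) / n →
      ∀ T : ℝ, 0 < T → D₀ * lam * (n : ℝ) ^ (1 / T) ≤ T →
      (Nat.card {H : {H : Lin U ℓ // Function.Surjective H} //
            T ≤ (maxLoad U ℓ S H.1 : ℝ)} : ℝ) /
          (Nat.card {H : Lin U ℓ // Function.Surjective H} : ℝ) ≤
        C₀ * (lam * (n : ℝ) ^ (1 / T) / T) ^ 2 := by
  classical
  refine ⟨4 * Real.exp 1 ^ 2, by positivity, 1, one_pos, ?_⟩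
  intro l U hlU S m n hS hn lam hlam T hT _
  obtain ⟨K, rfl⟩ := Nat.exists_eq_add_of_le hlU
  have hnpos : (0 : ℝ) < n := by rw [hn]; positivity
  have hn1 : (1 : ℝ) ≤ n := by rw [hn]; exact_mod_cast Nat.one_le_two_pow
  have hncast : (n : ℝ) = 2 ^ l := by rw [hn]; simp
  set q : ℝ := Real.exp 1 * (n : ℝ) ^ (1 / T) with hq
  have hp1 : (1 : ℝ) ≤ (n : ℝ) ^ (1 / T) := Real.one_le_rpow hn1 (by positivity)
  have he1 : (1 : ℝ) ≤ Real.exp 1 := Real.one_le_exp (by norm_num)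
  have hq1 : 1 ≤ q := by rw [hq]; nlinarith
  have hq0 : 0 < q := by linarith
  set g : (Fin (l + K) → ZMod 2) → ℝ := fun x => if x ∈ S then q else 1 with hg
  have hg1 : ∀ x, 1 ≤ g x := by
    intro x; simp only [hg]; split_ifs
    · exact hq1
    · exact le_rfl
  set a : ℝ := Real.exp (T / 2 ^ K) - 1 with ha
  have haT : T / 2 ^ K ≤ a := by
    have := Real.add_one_le_exp (T / 2 ^ K)
    linarith
  have hTK : 0 < T / 2 ^ K := by positivity
  have ha0 : 0 < a := by linarith
  have hpow : (1 + a) ^ (2 ^ K) = Real.exp T := by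
    rw [ha, add_sub_cancel, ← Real.exp_nat_mul]
    congr 1
    push_cast
    field_simp
  have mb := main_bound_s16 (W := Fin l → ZMod 2) l (by simp) K (Fin (l + K) → ZMod 2) (by simp)
    g hg1 a ha0
  rw [hpow] at mb
  have hsumg : (∑ x, g x) = 2 ^ (l + K) + m * (q - 1) := by
    have : ∀ x, g x = 1 + (if x ∈ S then (q - 1) else 0) := by
      intro x; simp only [hg]; split_ifs <;> ring
    rw [Finset.sum_congr rfl (fun x _ => this x), Finset.sum_add_distrib]
    simp [hS]
    ring
  have hal : (∑ x, g x) / 2 ^ (l + K) - 1 = lam * (q - 1) / 2 ^ K := by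
    rw [hsumg, hlam, hncast, pow_add]
    field_simp
    ring
  rw [hal] at mb
  have hlam0 : 0 ≤ lam := by rw [hlam]; positivity
  have hrat : lam * (q - 1) / 2 ^ K / a ≤ Real.exp 1 * (lam * (n : ℝ) ^ (1 / T) / T) := by
    calc lam * (q - 1) / 2 ^ K / a ≤ lam * (q - 1) / 2 ^ K / (T / 2 ^ K) := by
          apply div_le_div_of_nonneg_left _ hTK haT
          have : 0 ≤ q - 1 := by linarith
          positivity
      _ = lam * (q - 1) / T := by field_simp
      _ ≤ lam * q / T := by gcongr; linarith
      _ = _ := by rw [hq]; ring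
  have hrat0 : 0 ≤ lam * (q - 1) / 2 ^ K / a := by
    have : 0 ≤ q - 1 := by linarith
    positivity
  have himp : ∀ H : Lin (l + K) l, T ≤ (maxLoad (l + K) l S H : ℝ) →
      Real.exp T * 2 ^ l ≤ fibSum g H := by
    intro H hH
    obtain ⟨y, _, hy⟩ := Finset.exists_mem_eq_sup (Finset.univ : Finset (Fin l → ZMod 2))
      Finset.univ_nonempty (fun y => (S.filter fun v => H v = y).card)
    unfold maxLoad at hH
    rw [hy] at hH
    have hpos : ∀ y : Fin l → ZMod 2, 0 ≤ ∏ x ∈ Finset.univ.filter (fun x => H x = y), g x :=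
      fun y => Finset.prod_nonneg (fun x _ => by linarith [hg1 x])
    have h1 : ∏ x ∈ Finset.univ.filter (fun x => H x = y), g x ≤ fibSum g H := by
      have hfs : fibSum g H = ∑ y, ∏ x ∈ Finset.univ.filter (fun x => H x = y), g x := by
        unfold fibSum
        refine Finset.sum_congr rfl (fun y _ => Finset.prod_congr ?_ (fun _ _ => rfl))
        ext x
        simp only [Finset.mem_filter]
      rw [hfs]
      exact Finset.single_le_sum (f := fun y => ∏ x ∈ Finset.univ.filter (fun x => H x = y), g x)
        (fun y _ => hpos y) (Finset.mem_univ y)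
    refine le_trans ?_ h1
    have h2 : ∏ x ∈ Finset.univ.filter (fun x => H x = y), g x
        = q ^ (S.filter fun v => H v = y).card := by
      simp only [hg]
      rw [← Finset.prod_filter, Finset.prod_const]
      congr 2
      ext x
      simp [and_comm]
    rw [h2]
    calc Real.exp T * 2 ^ l = q ^ T := by
          rw [hq, Real.mul_rpow (by positivity) (by positivity), ← Real.rpow_mul hnpos.le,
            one_div_mul_cancel hT.ne', Real.rpow_one, ← Real.exp_mul, one_mul, hncast]
      _ ≤ q ^ (((S.filter fun v => H v = y).card : ℕ) : ℝ) :=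
          Real.rpow_le_rpow_of_exponent_le hq1 hH
      _ = _ := Real.rpow_natCast _ _
  have c1 : Nat.card {H : {H : Lin (l + K) l // Function.Surjective H} //
      T ≤ (maxLoad (l + K) l S H.1 : ℝ)} =
      cnt (fun H : Lin (l + K) l => T ≤ (maxLoad (l + K) l S H : ℝ)) := by
    unfold cnt
    exact Nat.card_congr (Equiv.subtypeSubtypeEquivSubtypeInter
      (fun H : Lin (l + K) l => Function.Surjective H)
      (fun H => T ≤ (maxLoad (l + K) l S H : ℝ)))
  have c2 : Nat.card {H : Lin (l + K) l // Function.Surjective H} =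
      cnt (fun _ : Lin (l + K) l => True) := by
    unfold cnt
    simp
  rw [c1, c2]
  have c3 : (cnt (fun H : Lin (l + K) l => T ≤ (maxLoad (l + K) l S H : ℝ)) : ℝ) ≤
      cnt (fun H : Lin (l + K) l => Real.exp T * 2 ^ l ≤ fibSum g H) := by
    exact_mod_cast cnt_mono _ _ (fun H _ h => himp H h)
  apply div_le_of_le_mul₀ (Nat.cast_nonneg _) (by positivity)
  refine (c3.trans mb).trans (mul_le_mul_of_nonneg_right ?_ (Nat.cast_nonneg _))
  calc 4 * (lam * (q - 1) / 2 ^ K / a) ^ 2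
      ≤ 4 * (Real.exp 1 * (lam * (n : ℝ) ^ (1 / T) / T)) ^ 2 := by gcongr
    _ = _ := by ring
end
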